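/- arXiv:1506.04856 — 2 statements merged into one kernel-verified Lean document; each statement's English description precedes it below -/
import Mathlib

section
/- Let d ≥ 1, p > 0 and α ∈ ℝ. The domain of the upsilon transform Ψ_{α,p} is: 𝔐^0 (all Lévy measures on ℝ^d) if α < 0; 𝔐^log if α = 0; 𝔐^α if α ∈ (0,2); and {0} (only the zero measure) if α ≥ 2. -/
open MeasureTheory Set

noncomputable section

variable {E : Type*} [NormedAddCommGroup E] [NormedSpace ℝ E]
  [MeasurableSpace E] [BorelSpace E]

/-- The upsilon transform with dilation measure `ρ` on `(0,∞) ⊆ ℝ`: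
`[Υ_ρ M](B) = ∫ M(s⁻¹ B) ρ(ds)`, realized as the image of `ρ ⊗ M` under `(s, x) ↦ s • x`. -/
def Upsilon (ρ : Measure ℝ) (M : Measure E) : Measure E :=
  Measure.map (fun sx : ℝ × E => sx.1 • sx.2) (ρ.prod M)

/-- `M` is a Lévy measure: σ-finite, no mass at `0`, and `∫ (|x|² ∧ 1) M(dx) < ∞`. -/
def IsLevyMeasure (M : Measure E) : Prop :=
  SigmaFinite M ∧ M {0} = 0 ∧
    ∫⁻ x, ENNReal.ofReal (min (‖x‖ ^ 2) 1) ∂M < ⊤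

/-- The domain `𝔇(Υ_ρ)`: Lévy measures `M` such that `Υ_ρ M` is again a Lévy measure. -/
def UpsilonDomain (ρ : Measure ℝ) : Set (Measure E) :=
  {M | IsLevyMeasure M ∧ IsLevyMeasure (Upsilon ρ M)}

/-- The range `ℜ(Υ_ρ) = {Υ_ρ M : M ∈ 𝔇(Υ_ρ)}`. -/
def UpsilonRange (ρ : Measure ℝ) : Set (Measure E) :=
  Upsilon ρ '' UpsilonDomain (E := E) ρ

/-- The class `𝔐^α`: Borel measures with `M({0}) = 0` and `∫ (|x|² ∧ |x|^α) M(dx) < ∞`. -/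
def MemMAlpha (α : ℝ) (M : Measure E) : Prop :=
  M {0} = 0 ∧ ∫⁻ x, ENNReal.ofReal (min (‖x‖ ^ 2) (‖x‖ ^ α)) ∂M < ⊤

/-- The class `𝔐^log`: Lévy measures with `∫_{|x|>1} log|x| M(dx) < ∞`. -/
def MemMLog (M : Measure E) : Prop :=
  IsLevyMeasure M ∧
    ∫⁻ x in {x : E | 1 < ‖x‖}, ENNReal.ofReal (Real.log ‖x‖) ∂M < ⊤

/-- The dilation measure `ψ_{α,p}(ds) = s^{-α-1} e^{-s^p} 1_{s>0} ds`. -/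
def psiMeasure (α p : ℝ) : Measure ℝ :=
  (volume : Measure ℝ).withDensity fun s =>
    if 0 < s then ENNReal.ofReal (s ^ (-α - 1) * Real.exp (-(s ^ p))) else 0

/-- `K_{α,β,p} = ∫₀^∞ u^{α-β-1} e^{-u^p} du`. -/
def Kconst (α β p : ℝ) : ℝ :=
  ∫ u in Ioi (0 : ℝ), u ^ (α - β - 1) * Real.exp (-(u ^ p))

/-- The dilation measure
`τ_{β→α,p}(ds) = K_{α,β,p}⁻¹ s^{-α-1} (1-s^p)^{(α-β)/p - 1} 1_{0<s<1} ds`. -/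
def tauMeasure (β α p : ℝ) : Measure ℝ :=
  (volume : Measure ℝ).withDensity fun s =>
    if 0 < s ∧ s < 1 then
      ENNReal.ofReal ((Kconst α β p)⁻¹ * (s ^ (-α - 1) * (1 - s ^ p) ^ ((α - β) / p - 1)))
    else 0

/-- `f` is the density of the fully right-skewed `r`-stable distribution on `(0,∞)`:
a nonnegative measurable function with `∫₀^∞ e^{-t x} f(x) dx = e^{-t^r}` for all `t ≥ 0`. -/
def IsStableDensity (r : ℝ) (f : ℝ → ℝ) : Prop :=
  Measurable f ∧ (∀ x, 0 ≤ f x) ∧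
    ∀ t : ℝ, 0 ≤ t →
      ∫ x in Ioi (0 : ℝ), Real.exp (-(t * x)) * f x = Real.exp (-(t ^ r))

/-- The dilation measure `π_{α,p→q}(ds) = p f_{q/p}(s^{-p}) s^{-α-p-1} 1_{s>0} ds`,
where `f` is (to be assumed) the density of the fully right-skewed `q/p`-stable law. -/
def piMeasure (f : ℝ → ℝ) (α p : ℝ) : Measure ℝ :=
  (volume : Measure ℝ).withDensity fun s =>
    if 0 < s then ENNReal.ofReal (p * f (s ^ (-p)) * s ^ (-α - p - 1)) else 0

/-- The measure `ρ(ds) = g(s) 1_{s>0} ds`. -/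
def densMeasure (g : ℝ → ℝ) : Measure ℝ :=
  (volume : Measure ℝ).withDensity fun s => if 0 < s then ENNReal.ofReal (g s) else 0

/-- The integral of `s ↦ (sr)² ∧ 1` with respect to `psiMeasure α p`. -/
def psiProfile (α p r : ℝ) : ENNReal :=
  ∫⁻ s in Ioi (0 : ℝ),
    ENNReal.ofReal (min ((s * r) ^ 2) 1 * (s ^ (-α - 1) * Real.exp (-(s ^ p))))

theorem sq_mul_rpow_neg_sub_one {s : ℝ} (hs : 0 < s) (α : ℝ) :
    s ^ 2 * s ^ (-α - 1) = s ^ (1 - α) := by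
  rw [← Real.rpow_natCast, ← Real.rpow_add hs]
  congr 1
  push_cast
  ring

theorem exp_neg_rpow_le_one {s : ℝ} (hs : 0 < s) (p : ℝ) : Real.exp (-(s ^ p)) ≤ 1 :=
  Real.exp_le_one_iff.2 (neg_nonpos.2 (Real.rpow_nonneg hs.le p))

theorem exp_neg_one_le_exp_neg_rpow {s p : ℝ} (hs : 0 < s) (hs1 : s ≤ 1) (hp : 0 < p) :
    Real.exp (-1) ≤ Real.exp (-(s ^ p)) :=
  Real.exp_le_exp.2 (neg_le_neg (Real.rpow_le_one hs.le hs1 hp.le))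

theorem sigmaFinite_of_lintegral_min_sq_lt_top {M : Measure E} (h0 : M {0} = 0)
    (h : ∫⁻ x, ENNReal.ofReal (min (‖x‖ ^ 2) 1) ∂M < ⊤) : SigmaFinite M := by
  refine ⟨⟨⟨fun n : ℕ => {0} ∪ {x : E | ENNReal.ofReal (1 / (n + 1)) ≤
    ENNReal.ofReal (min (‖x‖ ^ 2) 1)}, fun _ => trivial, fun n => ?_, ?_⟩⟩⟩
  · refine (measure_union_le _ _).trans_lt ?_
    rw [h0, zero_add]
    have hn : ENNReal.ofReal (1 / ((n : ℝ) + 1)) ≠ 0 := by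
      simp only [ne_eq, ENNReal.ofReal_eq_zero, not_le]
      positivity
    exact (meas_ge_le_lintegral_div (by fun_prop) hn ENNReal.ofReal_ne_top).trans_lt
      (ENNReal.div_lt_top h.ne hn)
  · refine eq_univ_of_forall fun x => mem_iUnion.2 ?_
    by_cases hx : x = 0
    · exact ⟨0, Or.inl hx⟩
    · have hpos : 0 < min (‖x‖ ^ 2) 1 := lt_min (by positivity) one_pos
      obtain ⟨n, hn⟩ := exists_nat_one_div_lt hpos
      exact ⟨n, Or.inr (ENNReal.ofReal_le_ofReal hn.le)⟩

theorem isLevyMeasure_iff {M : Measure E} :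
    IsLevyMeasure M ↔ M {0} = 0 ∧ ∫⁻ x, ENNReal.ofReal (min (‖x‖ ^ 2) 1) ∂M < ⊤ :=
  ⟨fun h => h.2, fun h => ⟨sigmaFinite_of_lintegral_min_sq_lt_top h.1 h.2, h.1, h.2⟩⟩

instance sFinite_psiMeasure (α p : ℝ) : SFinite (psiMeasure α p) := by
  unfold psiMeasure
  infer_instance

theorem measurable_psiMeasure_density (α p : ℝ) : Measurable fun s : ℝ =>
    if 0 < s then ENNReal.ofReal (s ^ (-α - 1) * Real.exp (-(s ^ p))) else 0 :=
  Measurable.ite measurableSet_Ioi (by fun_prop) measurable_const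

theorem ae_psiMeasure_pos (α p : ℝ) : ∀ᵐ s ∂psiMeasure α p, 0 < s := by
  rw [psiMeasure, ae_withDensity_iff (measurable_psiMeasure_density α p)]
  filter_upwards with s hs
  by_contra hneg
  exact hs (if_neg hneg)

theorem lintegral_psiMeasure (α p : ℝ) {g : ℝ → ENNReal} (hg : Measurable g) :
    ∫⁻ s, g s ∂psiMeasure α p =
      ∫⁻ s in Ioi (0 : ℝ), g s * ENNReal.ofReal (s ^ (-α - 1) * Real.exp (-(s ^ p))) := by
  rw [psiMeasure, lintegral_withDensity_eq_lintegral_mul _ (measurable_psiMeasure_density α p) hg,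
    ← lintegral_indicator measurableSet_Ioi]
  refine lintegral_congr fun s => ?_
  by_cases hs : 0 < s
  · simp [hs, mul_comm]
  · simp [hs]

theorem lintegral_min_sq_psiMeasure (α p r : ℝ) :
    ∫⁻ s, ENNReal.ofReal (min ((s * r) ^ 2) 1) ∂psiMeasure α p = psiProfile α p r := by
  rw [lintegral_psiMeasure α p (by fun_prop), psiProfile]
  refine lintegral_congr fun s => ?_
  rw [← ENNReal.ofReal_mul (le_min (sq_nonneg _) zero_le_one)]

theorem lintegral_min_sq_upsilon_psiMeasure [SecondCountableTopology E] (α p : ℝ)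
    (M : Measure E) [SFinite M] :
    ∫⁻ y, ENNReal.ofReal (min (‖y‖ ^ 2) 1) ∂Upsilon (psiMeasure α p) M =
      ∫⁻ x, psiProfile α p ‖x‖ ∂M := by
  rw [Upsilon, lintegral_map (by fun_prop) (by fun_prop), lintegral_prod_symm _ (by fun_prop)]
  refine lintegral_congr fun x => ?_
  rw [← lintegral_min_sq_psiMeasure]
  refine lintegral_congr fun s => ?_
  simp [norm_smul, mul_pow]

theorem upsilon_psiMeasure_singleton_zero [SecondCountableTopology E] (α p : ℝ)
    {M : Measure E} [SFinite M] (h0 : M {0} = 0) : Upsilon (psiMeasure α p) M {0} = 0 := by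
  have hmeas : Measurable fun sx : ℝ × E => sx.1 • sx.2 := by fun_prop
  rw [Upsilon, Measure.map_apply hmeas (measurableSet_singleton 0)]
  refine Measure.measure_prod_null_of_ae_null (hmeas (measurableSet_singleton 0)) ?_
  filter_upwards [ae_psiMeasure_pos α p] with s hs
  refine measure_mono_null (fun x hx => ?_) h0
  simpa [hs.ne'] using hx

theorem mem_upsilonDomain_psiMeasure_iff [SecondCountableTopology E] {α p : ℝ}
    {M : Measure E} :
    M ∈ UpsilonDomain (psiMeasure α p) ↔
      IsLevyMeasure M ∧ ∫⁻ x, psiProfile α p ‖x‖ ∂M < ⊤ := by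
  refine and_congr_right fun hM => ?_
  have := hM.1
  rw [isLevyMeasure_iff, lintegral_min_sq_upsilon_psiMeasure,
    and_iff_right (upsilon_psiMeasure_singleton_zero α p hM.2.1)]

theorem lintegral_rpow_mul_exp_neg_rpow_lt_top {p q : ℝ} (hp : 0 < p) (hq : -1 < q) :
    ∫⁻ s in Ioi (0 : ℝ), ENNReal.ofReal (s ^ q * Real.exp (-(s ^ p))) < ⊤ :=
  (integrableOn_rpow_mul_exp_neg_rpow hq hp).lintegral_lt_top

theorem psiProfile_le_mul_sq (α p r : ℝ) :
    psiProfile α p r ≤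
      (∫⁻ s in Ioi (0 : ℝ), ENNReal.ofReal (s ^ (1 - α) * Real.exp (-(s ^ p)))) *
        ENNReal.ofReal (r ^ 2) := by
  rw [← lintegral_mul_const' _ _ ENNReal.ofReal_ne_top]
  refine setLIntegral_mono' measurableSet_Ioi fun s (hs : 0 < s) => ?_
  have hw : 0 ≤ s ^ (-α - 1) * Real.exp (-(s ^ p)) := by positivity
  rw [← ENNReal.ofReal_mul (by positivity)]
  refine ENNReal.ofReal_le_ofReal ?_
  calc _ ≤ (s * r) ^ 2 * (s ^ (-α - 1) * Real.exp (-(s ^ p))) := by gcongr; exact min_le_left _ _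
    _ = _ := by rw [← sq_mul_rpow_neg_sub_one hs]; ring

theorem psiProfile_le_const (α p r : ℝ) :
    psiProfile α p r ≤
      ∫⁻ s in Ioi (0 : ℝ), ENNReal.ofReal (s ^ (-α - 1) * Real.exp (-(s ^ p))) := by
  refine setLIntegral_mono' measurableSet_Ioi fun s (hs : 0 < s) => ?_
  refine ENNReal.ofReal_le_ofReal ?_
  exact mul_le_of_le_one_left (by positivity) (min_le_right _ _)

theorem setLIntegral_rpow_neg_sub_one {α r : ℝ} (hα : α ≠ 0) (hr : 1 ≤ r) :
    ∫⁻ s in Ioc r⁻¹ 1, ENNReal.ofReal (s ^ (-α - 1)) = ENNReal.ofReal ((r ^ α - 1) / α) := by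
  have hr0 : 0 < r := by linarith
  have h0 : (0 : ℝ) ∉ uIcc r⁻¹ 1 := notMem_uIcc_of_lt (by positivity) one_pos
  have hle : r⁻¹ ≤ 1 := inv_le_one_of_one_le₀ hr
  have hint : IntervalIntegrable (fun s : ℝ => s ^ (-α - 1)) volume r⁻¹ 1 :=
    intervalIntegral.intervalIntegrable_rpow (Or.inr h0)
  rw [← ofReal_integral_eq_lintegral_ofReal ((intervalIntegrable_iff_integrableOn_Ioc_of_le hle).1
    hint), ← intervalIntegral.integral_of_le hle,
    integral_rpow (Or.inr ⟨fun h => hα (by linarith), h0⟩)]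
  · congr 1
    rw [sub_add_cancel, Real.one_rpow, Real.inv_rpow hr0.le, Real.rpow_neg hr0.le, inv_inv]
    field_simp
    ring
  · refine (ae_restrict_iff' measurableSet_Ioc).2 (.of_forall fun s hs => ?_)
    exact Real.rpow_nonneg ((inv_pos.2 hr0).trans hs.1).le _

theorem setLIntegral_inv {r : ℝ} (hr : 1 ≤ r) :
    ∫⁻ s in Ioc r⁻¹ 1, ENNReal.ofReal (s ^ (-0 - 1 : ℝ)) = ENNReal.ofReal (Real.log r) := by
  have hr0 : 0 < r := by linarith
  have h0 : (0 : ℝ) ∉ uIcc r⁻¹ 1 := notMem_uIcc_of_lt (by positivity) one_pos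
  have hle : r⁻¹ ≤ 1 := inv_le_one_of_one_le₀ hr
  have hint : IntervalIntegrable (fun s : ℝ => s ^ (-0 - 1 : ℝ)) volume r⁻¹ 1 :=
    intervalIntegral.intervalIntegrable_rpow (Or.inr h0)
  rw [← ofReal_integral_eq_lintegral_ofReal ((intervalIntegrable_iff_integrableOn_Ioc_of_le hle).1
    hint), ← intervalIntegral.integral_of_le hle]
  · simp only [neg_zero, zero_sub, Real.rpow_neg_one]
    rw [integral_inv h0, one_div, inv_inv]
  · refine (ae_restrict_iff' measurableSet_Ioc).2 (.of_forall fun s hs => ?_)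
    exact Real.rpow_nonneg ((inv_pos.2 hr0).trans hs.1).le _

theorem le_psiProfile {α p r : ℝ} (hp : 0 < p) (hr : 1 ≤ r) :
    ENNReal.ofReal (Real.exp (-1)) * ∫⁻ s in Ioc r⁻¹ 1, ENNReal.ofReal (s ^ (-α - 1)) ≤
      psiProfile α p r := by
  have hr0 : 0 < r := by linarith
  rw [← lintegral_const_mul' _ _ ENNReal.ofReal_ne_top]
  refine le_trans (setLIntegral_mono' measurableSet_Ioc fun s hs => ?_)
    (lintegral_mono_set fun s hs => (inv_pos.2 hr0).trans hs.1)
  have hs0 : 0 < s := (inv_pos.2 hr0).trans hs.1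
  have h1 : 1 ≤ s * r := by
    have := hs.1.le
    rwa [inv_le_iff_one_le_mul₀ hr0] at this
  rw [← ENNReal.ofReal_mul (by positivity), min_eq_right (one_le_pow₀ h1), one_mul,
    mul_comm (s ^ (-α - 1))]
  exact ENNReal.ofReal_le_ofReal (mul_le_mul_of_nonneg_right
    (exp_neg_one_le_exp_neg_rpow hs0 hs.2 hp) (by positivity))

theorem setLIntegral_Ioc_rpow_one_sub {α r : ℝ} (hα : α < 2) (hr : 0 < r) :
    ∫⁻ s in Ioc 0 r⁻¹, ENNReal.ofReal (r ^ 2 * s ^ (1 - α)) =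
      ENNReal.ofReal (r ^ α / (2 - α)) := by
  have hle : 0 ≤ r⁻¹ := by positivity
  have hint : IntervalIntegrable (fun s : ℝ => r ^ 2 * s ^ (1 - α)) volume 0 r⁻¹ :=
    (intervalIntegral.intervalIntegrable_rpow' (by linarith)).const_mul _
  rw [← ofReal_integral_eq_lintegral_ofReal ((intervalIntegrable_iff_integrableOn_Ioc_of_le hle).1
    hint), ← intervalIntegral.integral_of_le hle, intervalIntegral.integral_const_mul,
    integral_rpow (Or.inl (by linarith))]
  · have h2 : 1 - α + 1 = 2 - α := by ring
    rw [h2, Real.zero_rpow (by linarith), sub_zero, Real.inv_rpow hr.le, ← Real.rpow_neg hr.le,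
      ← mul_div_assoc, ← Real.rpow_natCast, ← Real.rpow_add hr]
    congr 3
    push_cast
    ring
  · refine (ae_restrict_iff' measurableSet_Ioc).2 (.of_forall fun s hs => ?_)
    exact mul_nonneg (by positivity) (Real.rpow_nonneg hs.1.le _)

theorem psiProfile_le_of_one_le {α p r : ℝ} (hα : α < 2) (hr : 1 ≤ r) :
    psiProfile α p r ≤
      ENNReal.ofReal (r ^ α / (2 - α)) + (∫⁻ s in Ioc r⁻¹ 1, ENNReal.ofReal (s ^ (-α - 1))) +
        ∫⁻ s in Ioi (0 : ℝ), ENNReal.ofReal (s ^ (1 - α) * Real.exp (-(s ^ p))) := by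
  have hr0 : 0 < r := by linarith
  have hsplit : Ioi (0 : ℝ) = Ioc 0 r⁻¹ ∪ Ioc r⁻¹ 1 ∪ Ioi 1 := by
    rw [Ioc_union_Ioc_eq_Ioc (by positivity) (inv_le_one_of_one_le₀ hr),
      Ioc_union_Ioi_eq_Ioi zero_le_one]
  rw [psiProfile, hsplit, ← setLIntegral_Ioc_rpow_one_sub hα hr0]
  refine (lintegral_union_le _ _ _).trans (add_le_add ((lintegral_union_le _ _ _).trans
    (add_le_add ?_ ?_)) (le_trans ?_ (lintegral_mono_set (hsplit ▸ Ioi_subset_Ioi zero_le_one))))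
  · refine setLIntegral_mono' measurableSet_Ioc fun s hs => ENNReal.ofReal_le_ofReal ?_
    have hs0 : 0 < s := hs.1
    calc _ ≤ (s * r) ^ 2 * (s ^ (-α - 1) * 1) := by
          gcongr
          · exact min_le_left _ _
          · exact exp_neg_rpow_le_one hs0 p
      _ = _ := by rw [← sq_mul_rpow_neg_sub_one hs0]; ring
  · refine setLIntegral_mono' measurableSet_Ioc fun s hs => ENNReal.ofReal_le_ofReal ?_
    have hs0 : 0 < s := (inv_pos.2 hr0).trans hs.1
    calc _ ≤ 1 * (s ^ (-α - 1) * 1) := by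
          gcongr
          · exact min_le_right _ _
          · exact exp_neg_rpow_le_one hs0 p
      _ = _ := by ring
  · refine setLIntegral_mono' measurableSet_Ioi fun s (hs : 1 < s) => ENNReal.ofReal_le_ofReal ?_
    have hs0 : 0 < s := by linarith
    calc _ ≤ s ^ 2 * (s ^ (-α - 1) * Real.exp (-(s ^ p))) := by
          gcongr
          exact (min_le_right _ _).trans (one_le_pow₀ hs.le)
      _ = _ := by rw [← sq_mul_rpow_neg_sub_one hs0]; ring

theorem psiProfile_eq_top {α p r : ℝ} (hp : 0 < p) (hα : 2 ≤ α) (hr : 0 < r) :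
    psiProfile α p r = ⊤ := by
  have ht : 0 < min 1 r⁻¹ := by positivity
  have hinf : ∫⁻ s in Ioo 0 (min 1 r⁻¹), ENNReal.ofReal (s ^ (1 - α)) = ⊤ := by
    by_contra h
    have hnn : 0 ≤ᵐ[volume.restrict (Ioo 0 (min 1 r⁻¹))] fun s : ℝ => s ^ (1 - α) :=
      (ae_restrict_iff' measurableSet_Ioo).2
        (.of_forall fun s hs => Real.rpow_nonneg hs.1.le _)
    have hint := (lintegral_ofReal_ne_top_iff_integrable
      (Measurable.aestronglyMeasurable (by fun_prop)) hnn).1 h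
    linarith [(intervalIntegral.integrableOn_Ioo_rpow_iff ht).1 hint]
  have hc : ENNReal.ofReal (Real.exp (-1) * r ^ 2) ≠ 0 := by
    simp only [ne_eq, ENNReal.ofReal_eq_zero, not_le]
    positivity
  rw [eq_top_iff, ← ENNReal.mul_top hc, ← hinf, ← lintegral_const_mul' _ _ ENNReal.ofReal_ne_top]
  refine le_trans (setLIntegral_mono' measurableSet_Ioo fun s hs => ?_)
    (lintegral_mono_set fun s hs => hs.1)
  have hs0 : 0 < s := hs.1
  have hs1 : s ≤ 1 := hs.2.le.trans (min_le_left _ _)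
  have hsr : s * r ≤ 1 := by
    simpa [hr.ne'] using mul_le_mul_of_nonneg_right (hs.2.le.trans (min_le_right _ _)) hr.le
  rw [← ENNReal.ofReal_mul (by positivity), min_eq_left (pow_le_one₀ (by positivity) hsr)]
  refine ENNReal.ofReal_le_ofReal ?_
  calc _ = (s * r) ^ 2 * (s ^ (-α - 1) * Real.exp (-1)) := by
        rw [← sq_mul_rpow_neg_sub_one hs0]; ring
    _ ≤ _ := by
        gcongr
        exact Real.rpow_le_one hs0.le hs1 hp.le

theorem upsilonDomain_psiMeasure_of_neg [SecondCountableTopology E] {α p : ℝ} (hp : 0 < p)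
    (hα : α < 0) : UpsilonDomain (E := E) (psiMeasure α p) = {M | IsLevyMeasure M} := by
  ext M
  rw [mem_upsilonDomain_psiMeasure_iff, mem_ofPred_eq]
  refine and_iff_left_of_imp fun hM => ?_
  set a := ∫⁻ s in Ioi (0 : ℝ), ENNReal.ofReal (s ^ (1 - α) * Real.exp (-(s ^ p))) with ha
  set b := ∫⁻ s in Ioi (0 : ℝ), ENNReal.ofReal (s ^ (-α - 1) * Real.exp (-(s ^ p))) with hb
  have ha' : a < ⊤ := lintegral_rpow_mul_exp_neg_rpow_lt_top hp (by linarith)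
  have hb' : b < ⊤ := lintegral_rpow_mul_exp_neg_rpow_lt_top hp (by linarith)
  have hab : a + b < ⊤ := ENNReal.add_lt_top.2 ⟨ha', hb'⟩
  calc ∫⁻ x, psiProfile α p ‖x‖ ∂M
      ≤ ∫⁻ x, (a + b) * ENNReal.ofReal (min (‖x‖ ^ 2) 1) ∂M := by
        refine lintegral_mono fun x => ?_
        rcases le_total (‖x‖ ^ 2) 1 with h | h
        · rw [min_eq_left h]
          exact (psiProfile_le_mul_sq α p ‖x‖).trans (mul_le_mul_left le_self_add _)
        · rw [min_eq_right h, ENNReal.ofReal_one, mul_one]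
          exact (psiProfile_le_const α p ‖x‖).trans le_add_self
    _ = (a + b) * ∫⁻ x, ENNReal.ofReal (min (‖x‖ ^ 2) 1) ∂M := lintegral_const_mul' _ _ hab.ne
    _ < ⊤ := ENNReal.mul_lt_top hab hM.2.2

theorem upsilonDomain_psiMeasure_zero [SecondCountableTopology E] {p : ℝ} (hp : 0 < p) :
    UpsilonDomain (E := E) (psiMeasure 0 p) = {M | MemMLog M} := by
  ext M
  rw [mem_upsilonDomain_psiMeasure_iff, mem_ofPred_eq]
  refine and_congr_right fun hM => ?_
  have hset : MeasurableSet {x : E | 1 < ‖x‖} := measurableSet_lt measurable_const measurable_norm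
  constructor
  · intro h
    have hne : ENNReal.ofReal (Real.exp (-1)) ≠ 0 := by simp [Real.exp_pos]
    refine ENNReal.lt_top_of_mul_ne_top_right (a := ENNReal.ofReal (Real.exp (-1)))
      (ne_top_of_le_ne_top h.ne ?_) hne
    rw [← lintegral_const_mul' _ _ ENNReal.ofReal_ne_top]
    refine le_trans (setLIntegral_mono' hset fun x (hx : 1 < ‖x‖) => ?_)
      (setLIntegral_le_lintegral _ _)
    rw [← setLIntegral_inv hx.le]
    exact le_psiProfile hp hx.le
  · intro h
    set a := ∫⁻ s in Ioi (0 : ℝ), ENNReal.ofReal (s ^ (1 - 0 : ℝ) * Real.exp (-(s ^ p))) with ha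
    have ha' : a < ⊤ := lintegral_rpow_mul_exp_neg_rpow_lt_top hp (by norm_num)
    have hab : a + 1 < ⊤ := ENNReal.add_lt_top.2 ⟨ha', ENNReal.one_lt_top⟩
    calc ∫⁻ x, psiProfile 0 p ‖x‖ ∂M
        ≤ ∫⁻ x, (a + 1) * ENNReal.ofReal (min (‖x‖ ^ 2) 1) +
            {x : E | 1 < ‖x‖}.indicator (fun x => ENNReal.ofReal (Real.log ‖x‖)) x ∂M := by
          refine lintegral_mono fun x => ?_
          rcases le_or_gt ‖x‖ 1 with h1 | h1
          · rw [min_eq_left (pow_le_one₀ (norm_nonneg _) h1)]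
            exact ((psiProfile_le_mul_sq 0 p ‖x‖).trans (mul_le_mul_left le_self_add _)).trans
              le_self_add
          · rw [min_eq_right (one_le_pow₀ h1.le), ENNReal.ofReal_one, mul_one,
              indicator_of_mem (show x ∈ {x : E | 1 < ‖x‖} from h1)]
            refine (psiProfile_le_of_one_le two_pos h1.le).trans ?_
            rw [setLIntegral_inv h1.le, add_right_comm, add_comm a]
            gcongr
            rw [Real.rpow_zero]
            exact ENNReal.ofReal_le_one.2 (by norm_num)
      _ = (a + 1) * (∫⁻ x, ENNReal.ofReal (min (‖x‖ ^ 2) 1) ∂M) +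
            ∫⁻ x in {x : E | 1 < ‖x‖}, ENNReal.ofReal (Real.log ‖x‖) ∂M := by
          rw [lintegral_add_left (by fun_prop), lintegral_const_mul' _ _ hab.ne,
            lintegral_indicator hset]
      _ < ⊤ := ENNReal.add_lt_top.2 ⟨ENNReal.mul_lt_top hab hM.2.2, h⟩

theorem min_sq_one_le_min_sq_rpow {α r : ℝ} (hα : 0 ≤ α) (hα2 : α ≤ 2) (hr : 0 ≤ r) :
    min (r ^ 2) 1 ≤ min (r ^ 2) (r ^ α) := by
  refine le_min (min_le_left _ _) ?_
  rcases le_total 1 r with h | h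
  · exact (min_le_right _ _).trans (Real.one_le_rpow h hα)
  · refine (min_le_left _ _).trans ?_
    rw [← Real.rpow_natCast]
    exact Real.rpow_le_rpow_of_exponent_ge_of_imp hr h (by push_cast; exact hα2) (by norm_num)

theorem upsilonDomain_psiMeasure_of_pos_of_lt_two [SecondCountableTopology E] {α p : ℝ}
    (hp : 0 < p) (hα : 0 < α) (hα2 : α < 2) :
    UpsilonDomain (E := E) (psiMeasure α p) = {M | MemMAlpha α M} := by
  ext M
  rw [mem_upsilonDomain_psiMeasure_iff, mem_ofPred_eq]
  constructor
  · rintro ⟨hM, h⟩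
    refine ⟨hM.2.1, ?_⟩
    have hk : 0 ≤ α * Real.exp 1 := by positivity
    calc ∫⁻ x, ENNReal.ofReal (min (‖x‖ ^ 2) (‖x‖ ^ α)) ∂M
        ≤ ∫⁻ x, ENNReal.ofReal (min (‖x‖ ^ 2) 1) +
            ENNReal.ofReal (α * Real.exp 1) * psiProfile α p ‖x‖ ∂M := by
          refine lintegral_mono fun x => ?_
          rcases le_or_gt ‖x‖ 1 with h1 | h1
          · rw [min_eq_left (pow_le_one₀ (norm_nonneg _) h1)]
            exact (ENNReal.ofReal_le_ofReal (min_le_left _ _)).trans le_self_add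
          · have hL := le_psiProfile (α := α) hp h1.le
            rw [setLIntegral_rpow_neg_sub_one hα.ne' h1.le,
              ← ENNReal.ofReal_mul (by positivity)] at hL
            have hpow : 1 ≤ ‖x‖ ^ α := Real.one_le_rpow h1.le hα.le
            rw [min_eq_right (one_le_pow₀ h1.le)]
            refine le_trans ?_ (add_le_add_right (mul_le_mul_right hL _) _)
            rw [← ENNReal.ofReal_mul hk, ← ENNReal.ofReal_add zero_le_one]
            · refine ENNReal.ofReal_le_ofReal ((min_le_right _ _).trans (le_of_eq ?_))
              rw [Real.exp_neg]
              field_simp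
              ring
            · have : 0 ≤ ‖x‖ ^ α - 1 := by linarith
              positivity
      _ = (∫⁻ x, ENNReal.ofReal (min (‖x‖ ^ 2) 1) ∂M) +
            ENNReal.ofReal (α * Real.exp 1) * ∫⁻ x, psiProfile α p ‖x‖ ∂M := by
          rw [lintegral_add_left (by fun_prop), lintegral_const_mul' _ _ ENNReal.ofReal_ne_top]
      _ < ⊤ := ENNReal.add_lt_top.2 ⟨hM.2.2, ENNReal.mul_lt_top ENNReal.ofReal_lt_top h⟩
  · rintro ⟨h0, h⟩
    refine ⟨isLevyMeasure_iff.2 ⟨h0, (lintegral_mono fun x => ENNReal.ofReal_le_ofReal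
      (min_sq_one_le_min_sq_rpow hα.le hα2.le (norm_nonneg x))).trans_lt h⟩, ?_⟩
    set a := ∫⁻ s in Ioi (0 : ℝ), ENNReal.ofReal (s ^ (1 - α) * Real.exp (-(s ^ p))) with ha
    set b := ENNReal.ofReal (1 / (2 - α)) + ENNReal.ofReal (1 / α) with hb
    have hα2' : 0 < 2 - α := by linarith
    have ha' : a < ⊤ := lintegral_rpow_mul_exp_neg_rpow_lt_top hp (by linarith)
    have hab : b + a < ⊤ :=
      ENNReal.add_lt_top.2 ⟨ENNReal.add_lt_top.2 ⟨ENNReal.ofReal_lt_top, ENNReal.ofReal_lt_top⟩, ha'⟩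
    calc ∫⁻ x, psiProfile α p ‖x‖ ∂M
        ≤ ∫⁻ x, (b + a) * ENNReal.ofReal (min (‖x‖ ^ 2) (‖x‖ ^ α)) ∂M := by
          refine lintegral_mono fun x => ?_
          rcases le_or_gt ‖x‖ 1 with h1 | h1
          · have hmin : min (‖x‖ ^ 2) (‖x‖ ^ α) = ‖x‖ ^ 2 := by
              have := min_sq_one_le_min_sq_rpow hα.le hα2.le (norm_nonneg x)
              rw [min_eq_left (pow_le_one₀ (norm_nonneg _) h1)] at this
              exact le_antisymm (min_le_left _ _) this
            rw [hmin]
            exact (psiProfile_le_mul_sq α p ‖x‖).trans (mul_le_mul_left le_add_self _)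
          · have hmin : min (‖x‖ ^ 2) (‖x‖ ^ α) = ‖x‖ ^ α := by
              refine min_eq_right ?_
              rw [← Real.rpow_natCast]
              exact Real.rpow_le_rpow_of_exponent_le h1.le (by push_cast; linarith)
            have hpow : 1 ≤ ‖x‖ ^ α := Real.one_le_rpow h1.le hα.le
            refine (psiProfile_le_of_one_le hα2 h1.le).trans ?_
            rw [setLIntegral_rpow_neg_sub_one hα.ne' h1.le, hmin, add_mul, add_mul,
              ← ENNReal.ofReal_mul (by positivity), ← ENNReal.ofReal_mul (by positivity)]
            refine add_le_add (add_le_add ?_ ?_) ?_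
            · rw [one_div_mul_eq_div]
            · rw [one_div_mul_eq_div]
              gcongr
              linarith
            · exact le_mul_of_one_le_right' (ENNReal.one_le_ofReal.2 hpow)
      _ = (b + a) * ∫⁻ x, ENNReal.ofReal (min (‖x‖ ^ 2) (‖x‖ ^ α)) ∂M :=
          lintegral_const_mul' _ _ hab.ne
      _ < ⊤ := ENNReal.mul_lt_top hab h

theorem upsilonDomain_psiMeasure_of_two_le [SecondCountableTopology E] {α p : ℝ}
    (hp : 0 < p) (hα : 2 ≤ α) : UpsilonDomain (E := E) (psiMeasure α p) = {0} := by
  ext M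
  rw [mem_upsilonDomain_psiMeasure_iff, mem_singleton_iff]
  constructor
  · rintro ⟨hM, h⟩
    have hcompl : M {0}ᶜ = 0 := by
      by_contra hne
      refine h.ne (eq_top_iff.2 ?_)
      calc (⊤ : ENNReal) = ∫⁻ _ in ({0}ᶜ : Set E), ⊤ ∂M := by
            rw [setLIntegral_const, ENNReal.top_mul hne]
        _ ≤ ∫⁻ x in ({0}ᶜ : Set E), psiProfile α p ‖x‖ ∂M :=
            setLIntegral_mono' (measurableSet_singleton 0).compl fun x hx =>
              (psiProfile_eq_top hp hα (norm_pos_iff.2 hx)).ge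
        _ ≤ _ := setLIntegral_le_lintegral _ _
    rw [← Measure.measure_univ_eq_zero, ← union_compl_self ({0} : Set E)]
    exact measure_union_null hM.2.1 hcompl
  · rintro rfl
    simp [isLevyMeasure_iff]

theorem stmt0 (d : ℕ) (hd : 1 ≤ d) (α p : ℝ) (hp : 0 < p) :
    (α < 0 →
      UpsilonDomain (E := EuclideanSpace ℝ (Fin d)) (psiMeasure α p) =
        {M | IsLevyMeasure M}) ∧
    (α = 0 →
      UpsilonDomain (E := EuclideanSpace ℝ (Fin d)) (psiMeasure α p) =
        {M | MemMLog M}) ∧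
    (0 < α → α < 2 →
      UpsilonDomain (E := EuclideanSpace ℝ (Fin d)) (psiMeasure α p) =
        {M | MemMAlpha α M}) ∧
    (2 ≤ α →
      UpsilonDomain (E := EuclideanSpace ℝ (Fin d)) (psiMeasure α p) = {0}) := by
  refine ⟨upsilonDomain_psiMeasure_of_neg hp, ?_, upsilonDomain_psiMeasure_of_pos_of_lt_two hp,
    upsilonDomain_psiMeasure_of_two_le hp⟩
  rintro rfl
  exact upsilonDomain_psiMeasure_zero hp
end
end

section
/- Let d ≥ 1, α ∈ ℝ and 0 < q < p < ∞. The domain of the upsilon transform 𝔓_{α,p→q} is: 𝔐^0 (all Lévy measures on ℝ^d) if α − q < 0; 𝔐^log if α − q = 0; 𝔐^{α−q} if α − q ∈ (0,2); and {0} (only the zero measure) if α − q ≥ 2. -/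
open MeasureTheory Set

noncomputable section

variable {E : Type*} [NormedAddCommGroup E] [NormedSpace ℝ E]
  [MeasurableSpace E] [BorelSpace E]

open scoped ENNReal

theorem Real.rpow_le_mul_rpow_of_le_of_le {s t K : ℝ} (a : ℝ) (hs : 0 < s) (hst : s ≤ t)
    (htK : t ≤ K * s) : t ^ a ≤ K ^ |a| * s ^ a := by
  have h1 : 1 ≤ t / s := (one_le_div hs).2 hst
  have h2 : t / s ≤ K := (div_le_iff₀ hs).2 htK
  have h0 : 0 < t := hs.trans_le hst
  have : t ^ a = (t / s) ^ a * s ^ a := by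
    rw [← Real.mul_rpow (by positivity) hs.le, div_mul_cancel₀ _ hs.ne']
  rw [this]
  gcongr
  exact (Real.rpow_le_rpow_of_exponent_le h1 (le_abs_self a)).trans
    (Real.rpow_le_rpow (by linarith) h2 (abs_nonneg a))

theorem Real.rpow_le_mul_rpow_of_le_of_le' {s t K : ℝ} (a : ℝ) (hs : 0 < s) (hst : s ≤ t)
    (htK : t ≤ K * s) : s ^ a ≤ K ^ |a| * t ^ a := by
  have h1 : 1 ≤ t / s := (one_le_div hs).2 hst
  have h2 : t / s ≤ K := (div_le_iff₀ hs).2 htK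
  have h0 : 0 < t := hs.trans_le hst
  have : s ^ a = (t / s) ^ (-a) * t ^ a := by
    rw [Real.rpow_neg (by positivity), ← Real.inv_rpow (by positivity), inv_div,
      ← Real.mul_rpow (by positivity) h0.le, div_mul_cancel₀ _ h0.ne']
  rw [this]
  gcongr
  exact (Real.rpow_le_rpow_of_exponent_le h1 (neg_le_abs a)).trans
    (Real.rpow_le_rpow (by linarith) h2 (abs_nonneg a))

theorem setLIntegral_Ioo_zero_rpow {r b : ℝ} (hr : 0 < r) (hb : 0 ≤ b) :
    ∫⁻ σ in Ioo 0 b, ENNReal.ofReal (σ ^ (r - 1)) = ENNReal.ofReal (b ^ r / r) := by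
  have hi : IntervalIntegrable (fun σ : ℝ => σ ^ (r - 1)) volume 0 b :=
    intervalIntegral.intervalIntegrable_rpow' (by linarith)
  rw [restrict_Ioo_eq_restrict_Ioc, ← ofReal_integral_eq_lintegral_ofReal,
    ← intervalIntegral.integral_of_le hb, integral_rpow (Or.inl (by linarith))]
  · simp [hr.ne']
  · exact (intervalIntegrable_iff_integrableOn_Ioc_of_le hb).1 hi
  · filter_upwards [ae_restrict_mem measurableSet_Ioc] with σ hσ
    exact Real.rpow_nonneg hσ.1.le _

theorem setLIntegral_Ioo_zero_rpow_eq_top {r b : ℝ} (hr : r ≤ 0) (hb : 0 < b) :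
    ∫⁻ σ in Ioo 0 b, ENNReal.ofReal (σ ^ (r - 1)) = ∞ := by
  by_contra h
  have h1 : ¬ IntegrableOn (fun σ : ℝ => σ ^ (r - 1)) (Ioo 0 b) := by
    rw [intervalIntegral.integrableOn_Ioo_rpow_iff hb]
    linarith
  refine h1 ((lintegral_ofReal_ne_top_iff_integrable ?_ ?_).1 h)
  · fun_prop
  · filter_upwards [ae_restrict_mem measurableSet_Ioo] with σ hσ
    exact Real.rpow_nonneg hσ.1.le _

theorem setLIntegral_Ioi_rpow {r b : ℝ} (hr : r < 0) (hb : 0 < b) :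
    ∫⁻ σ in Ioi b, ENNReal.ofReal (σ ^ (r - 1)) = ENNReal.ofReal (b ^ r / (-r)) := by
  rw [← ofReal_integral_eq_lintegral_ofReal, integral_Ioi_rpow_of_lt (by linarith) hb]
  · simp [neg_div, div_neg]
  · exact integrableOn_Ioi_rpow_of_lt (by linarith) hb
  · filter_upwards [ae_restrict_mem measurableSet_Ioi] with σ hσ
    exact Real.rpow_nonneg (hb.trans hσ).le _

theorem setLIntegral_Ioo_rpow_neg_one {a b : ℝ} (ha : 0 < a) (hab : a ≤ b) :
    ∫⁻ σ in Ioo a b, ENNReal.ofReal (σ ^ (-1 : ℝ)) = ENNReal.ofReal (Real.log (b / a)) := by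
  have hi : IntervalIntegrable (fun σ : ℝ => σ ^ (-1 : ℝ)) volume a b :=
    intervalIntegral.intervalIntegrable_rpow
      (Or.inr (notMem_uIcc_of_lt ha (ha.trans_le hab)))
  rw [restrict_Ioo_eq_restrict_Ioc, ← ofReal_integral_eq_lintegral_ofReal,
    ← intervalIntegral.integral_of_le hab]
  · simp_rw [Real.rpow_neg_one]
    rw [integral_inv_of_pos ha (ha.trans_le hab)]
  · exact (intervalIntegrable_iff_integrableOn_Ioc_of_le hab).1 hi
  · filter_upwards [ae_restrict_mem measurableSet_Ioc] with σ hσ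
    exact Real.rpow_nonneg (ha.trans hσ.1).le _

theorem one_le_sq_mul_min {K s u : ℝ} (hK : 1 ≤ K) (h : 1 ≤ K * (s * u)) :
    1 ≤ K ^ 2 * min (s ^ 2 * u ^ 2) 1 := by
  rw [mul_min_of_nonneg _ _ (by positivity)]
  refine le_min ?_ ?_
  · calc (1 : ℝ) ≤ (K * (s * u)) ^ 2 := one_le_pow₀ h
      _ = _ := by ring
  · rw [mul_one]
    exact one_le_pow₀ hK

/-- A finite measure on `(0, ∞)` all of whose positive moments are finite and whose mass near
`0` behaves, up to constants and dilations, like `s ^ q`. -/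
structure HasPowerTail (μ : Measure ℝ) (q : ℝ) : Prop where
  pos : ∀ᵐ s ∂μ, 0 < s
  upper : ∃ C : ℝ, ∀ σ > 0, μ (Iic σ) ≤ ENNReal.ofReal (C * σ ^ q)
  lower : ∃ K > 1, ∃ c > 0, ∀ σ ∈ Ioc (0 : ℝ) 1,
    ENNReal.ofReal (c * σ ^ q) ≤ μ (Ioc (σ / K) σ)
  moment : ∀ k : ℝ, 0 ≤ k → ∫⁻ s, ENNReal.ofReal (s ^ k) ∂μ < ∞

namespace HasPowerTail

variable {μ : Measure ℝ} {q : ℝ}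

theorem isFiniteMeasure (h : HasPowerTail μ q) : IsFiniteMeasure μ :=
  ⟨by simpa using h.moment 0 le_rfl⟩

theorem exists_setLIntegral_rpow_le (h : HasPowerTail μ q) (κ : ℝ) :
    ∃ C : ℝ≥0∞, C ≠ ∞ ∧ ∀ A B : Set ℝ, MeasurableSet A → MeasurableSet B → A ⊆ Ioi 0 →
      B ⊆ Ioi 0 → (∀ s ∈ A, Ioo s (2 * s) ⊆ B) →
      ∫⁻ s in A, ENNReal.ofReal (s ^ (-κ)) ∂μ ≤
        C * ∫⁻ σ in B, ENNReal.ofReal (σ ^ (q - κ - 1)) := by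
  have := h.isFiniteMeasure
  obtain ⟨C, hC⟩ := h.upper
  refine ⟨ENNReal.ofReal (2 ^ |-κ - 1|) * ENNReal.ofReal C, by finiteness, ?_⟩
  intro A B hA hB hA0 hB0 hAB
  set g : ℝ → ℝ → ℝ≥0∞ := fun s σ =>
    (Ioi s).indicator (fun σ => ENNReal.ofReal (σ ^ (-κ - 1))) σ with hg
  have hgm : Measurable (Function.uncurry g) := by
    have : Function.uncurry g = {x : ℝ × ℝ | x.1 < x.2}.indicator
        (fun x => ENNReal.ofReal (x.2 ^ (-κ - 1))) := by
      ext ⟨s, σ⟩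
      simp [hg, Function.uncurry, indicator]
    rw [this]
    exact Measurable.indicator (by fun_prop) (measurableSet_lt measurable_fst measurable_snd)
  calc ∫⁻ s in A, ENNReal.ofReal (s ^ (-κ)) ∂μ
      ≤ ∫⁻ s in A, (ENNReal.ofReal (2 ^ |-κ - 1|) * ∫⁻ σ in B, g s σ) ∂μ := by
        refine setLIntegral_mono' hA fun s hs => ?_
        have hs0 : 0 < s := hA0 hs
        calc ENNReal.ofReal (s ^ (-κ))
            = ∫⁻ σ in Ioo s (2 * s), ENNReal.ofReal (s ^ (-κ - 1)) := by
              rw [setLIntegral_const, Real.volume_Ioo,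
                ← ENNReal.ofReal_mul (by positivity), show 2 * s - s = s by ring,
                ← Real.rpow_add_one hs0.ne']
              ring_nf
          _ ≤ ∫⁻ σ in Ioo s (2 * s),
                ENNReal.ofReal (2 ^ |-κ - 1|) * ENNReal.ofReal (σ ^ (-κ - 1)) := by
              refine setLIntegral_mono' measurableSet_Ioo fun σ hσ => ?_
              rw [← ENNReal.ofReal_mul (by positivity)]
              exact ENNReal.ofReal_le_ofReal
                (Real.rpow_le_mul_rpow_of_le_of_le' _ hs0 hσ.1.le hσ.2.le)
          _ = ENNReal.ofReal (2 ^ |-κ - 1|) *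
                ∫⁻ σ in Ioo s (2 * s), ENNReal.ofReal (σ ^ (-κ - 1)) :=
              lintegral_const_mul _ (by fun_prop)
          _ = ENNReal.ofReal (2 ^ |-κ - 1|) * ∫⁻ σ in Ioo s (2 * s), g s σ := by
              congr 1
              refine setLIntegral_congr_fun measurableSet_Ioo fun σ hσ => ?_
              simp [hg, indicator, hσ.1]
          _ ≤ ENNReal.ofReal (2 ^ |-κ - 1|) * ∫⁻ σ in B, g s σ := by
              gcongr
              exact hAB s hs
    _ = ENNReal.ofReal (2 ^ |-κ - 1|) * ∫⁻ s in A, (∫⁻ σ in B, g s σ) ∂μ :=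
        lintegral_const_mul _ hgm.lintegral_prod_right'
    _ = ENNReal.ofReal (2 ^ |-κ - 1|) * ∫⁻ σ in B, ∫⁻ s in A, g s σ ∂μ := by
        rw [lintegral_lintegral_swap hgm.aemeasurable]
    _ ≤ ENNReal.ofReal (2 ^ |-κ - 1|) *
          ∫⁻ σ in B, ENNReal.ofReal C * ENNReal.ofReal (σ ^ (q - κ - 1)) := by
        gcongr _ * ?_
        refine setLIntegral_mono' hB fun σ hσ => ?_
        have hσ0 : 0 < σ := hB0 hσ
        calc ∫⁻ s in A, g s σ ∂μ ≤ ∫⁻ s, g s σ ∂μ := setLIntegral_le_lintegral _ _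
          _ ≤ ∫⁻ s, (Iic σ).indicator (fun _ => ENNReal.ofReal (σ ^ (-κ - 1))) s ∂μ := by
              refine lintegral_mono fun s => ?_
              rcases lt_or_ge s σ with hs | hs
              · simp [hg, indicator, hs, hs.le]
              · simp [hg, indicator, hs.not_gt]
          _ = ENNReal.ofReal (σ ^ (-κ - 1)) * μ (Iic σ) := by
              rw [lintegral_indicator measurableSet_Iic, setLIntegral_const]
          _ ≤ ENNReal.ofReal (σ ^ (-κ - 1)) * ENNReal.ofReal (C * σ ^ q) := by
              gcongr
              exact hC σ hσ0
          _ = ENNReal.ofReal C * ENNReal.ofReal (σ ^ (q - κ - 1)) := by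
              rw [ENNReal.ofReal_mul' (by positivity), mul_left_comm,
                ← ENNReal.ofReal_mul (by positivity), ← Real.rpow_add hσ0]
              ring_nf
    _ = _ := by
        rw [lintegral_const_mul _ (by fun_prop), mul_assoc]

theorem exists_setLIntegral_rpow_ge (h : HasPowerTail μ q) (κ : ℝ) :
    ∃ K > 1, ∃ C : ℝ≥0∞, C ≠ ∞ ∧ ∀ A B : Set ℝ, MeasurableSet A → MeasurableSet B →
      A ⊆ Ioc 0 1 → B ⊆ Ioi 0 → (∀ σ ∈ A, Ioc (σ / K) σ ⊆ B) →
      ∫⁻ σ in A, ENNReal.ofReal (σ ^ (q - κ - 1)) ≤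
        C * ∫⁻ s in B, ENNReal.ofReal (s ^ (-κ)) ∂μ := by
  have := h.isFiniteMeasure
  obtain ⟨K, hK, c, hc, hl⟩ := h.lower
  have hK0 : 0 < K := by linarith
  refine ⟨K, hK, ENNReal.ofReal c⁻¹ * ENNReal.ofReal (K ^ |-κ - 1| * K), by finiteness, ?_⟩
  intro A B hA hB hA0 hB0 hAB
  set g : ℝ → ℝ → ℝ≥0∞ := fun s σ =>
    (Icc s (K * s)).indicator (fun σ => ENNReal.ofReal (σ ^ (-κ - 1))) σ with hg
  have hgm : Measurable (Function.uncurry g) := by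
    have : Function.uncurry g = {x : ℝ × ℝ | x.1 ≤ x.2 ∧ x.2 ≤ K * x.1}.indicator
        (fun x => ENNReal.ofReal (x.2 ^ (-κ - 1))) := by
      ext ⟨s, σ⟩
      simp [hg, Function.uncurry, indicator]
    rw [this]
    exact Measurable.indicator (by fun_prop) ((measurableSet_le measurable_fst
      measurable_snd).inter (measurableSet_le measurable_snd (by fun_prop)))
  calc ∫⁻ σ in A, ENNReal.ofReal (σ ^ (q - κ - 1))
      ≤ ∫⁻ σ in A, ENNReal.ofReal c⁻¹ * ∫⁻ s in B, g s σ ∂μ := by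
        refine setLIntegral_mono' hA fun σ hσ => ?_
        have hσ0 : 0 < σ := (hA0 hσ).1
        calc ENNReal.ofReal (σ ^ (q - κ - 1))
            = ENNReal.ofReal c⁻¹ *
                (ENNReal.ofReal (σ ^ (-κ - 1)) * ENNReal.ofReal (c * σ ^ q)) := by
              rw [← ENNReal.ofReal_mul (by positivity), ← ENNReal.ofReal_mul (by positivity),
                mul_left_comm _ c, inv_mul_cancel_left₀ hc.ne', ← Real.rpow_add hσ0]
              ring_nf
          _ ≤ ENNReal.ofReal c⁻¹ *
                (ENNReal.ofReal (σ ^ (-κ - 1)) * μ (Ioc (σ / K) σ)) := by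
              gcongr
              exact hl σ (hA0 hσ)
          _ = ENNReal.ofReal c⁻¹ *
                ∫⁻ s in Ioc (σ / K) σ, ENNReal.ofReal (σ ^ (-κ - 1)) ∂μ := by
              rw [setLIntegral_const]
          _ = ENNReal.ofReal c⁻¹ * ∫⁻ s in Ioc (σ / K) σ, g s σ ∂μ := by
              congr 1
              refine setLIntegral_congr_fun measurableSet_Ioc fun s hs => ?_
              have : σ ≤ K * s := by
                have := (div_lt_iff₀ hK0).1 hs.1
                linarith
              simp [hg, indicator, hs.2, this]
          _ ≤ ENNReal.ofReal c⁻¹ * ∫⁻ s in B, g s σ ∂μ := by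
              gcongr
              exact hAB σ hσ
    _ = ENNReal.ofReal c⁻¹ * ∫⁻ σ in A, ∫⁻ s in B, g s σ ∂μ :=
        lintegral_const_mul _ hgm.lintegral_prod_left'
    _ = ENNReal.ofReal c⁻¹ * ∫⁻ s in B, (∫⁻ σ in A, g s σ) ∂μ := by
        rw [lintegral_lintegral_swap hgm.aemeasurable]
    _ ≤ ENNReal.ofReal c⁻¹ *
          ∫⁻ s in B, ENNReal.ofReal (K ^ |-κ - 1| * K) * ENNReal.ofReal (s ^ (-κ)) ∂μ := by
        gcongr _ * ?_
        refine setLIntegral_mono' hB fun s hs => ?_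
        have hs0 : 0 < s := hB0 hs
        calc ∫⁻ σ in A, g s σ ≤ ∫⁻ σ, g s σ := setLIntegral_le_lintegral _ _
          _ = ∫⁻ σ in Icc s (K * s), ENNReal.ofReal (σ ^ (-κ - 1)) :=
              lintegral_indicator measurableSet_Icc _
          _ ≤ ∫⁻ σ in Icc s (K * s), ENNReal.ofReal (K ^ |-κ - 1| * s ^ (-κ - 1)) := by
              refine setLIntegral_mono' measurableSet_Icc fun σ hσ => ?_
              exact ENNReal.ofReal_le_ofReal
                (Real.rpow_le_mul_rpow_of_le_of_le _ hs0 hσ.1 hσ.2)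
          _ = ENNReal.ofReal (K ^ |-κ - 1| * s ^ (-κ - 1)) * ENNReal.ofReal (K * s - s) := by
              rw [setLIntegral_const, Real.volume_Icc]
          _ ≤ ENNReal.ofReal (K ^ |-κ - 1| * s ^ (-κ - 1)) * ENNReal.ofReal (K * s) := by
              gcongr
              linarith
          _ = _ := by
              rw [← ENNReal.ofReal_mul (by positivity), ← ENNReal.ofReal_mul (by positivity)]
              congr 1
              rw [show -κ = -κ - 1 + 1 by ring, Real.rpow_add_one hs0.ne']
              ring_nf
    _ = _ := by
        rw [lintegral_const_mul _ (by fun_prop), mul_assoc]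

theorem exists_setLIntegral_Ioo_le (h : HasPowerTail μ q) {κ : ℝ} (hκ : κ < q) :
    ∃ C : ℝ≥0∞, C ≠ ∞ ∧ ∀ b > 0, ∫⁻ s in Ioo 0 b, ENNReal.ofReal (s ^ (-κ)) ∂μ ≤
      C * ENNReal.ofReal (b ^ (q - κ)) := by
  obtain ⟨C, hC, hle⟩ := h.exists_setLIntegral_rpow_le κ
  refine ⟨C * ENNReal.ofReal (2 ^ (q - κ) / (q - κ)), by finiteness, fun b hb => ?_⟩
  refine (hle (Ioo 0 b) (Ioo 0 (2 * b)) measurableSet_Ioo measurableSet_Ioo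
    Ioo_subset_Ioi_self Ioo_subset_Ioi_self fun s hs σ hσ =>
      ⟨hs.1.trans hσ.1, hσ.2.trans (by linarith [hs.2])⟩).trans_eq ?_
  have : 0 < q - κ := by linarith
  rw [setLIntegral_Ioo_zero_rpow this (by positivity), mul_assoc,
    ← ENNReal.ofReal_mul (by positivity), Real.mul_rpow (by positivity) hb.le]
  ring_nf

theorem exists_setLIntegral_Ici_le (h : HasPowerTail μ q) {κ : ℝ} (hκ : q < κ) :
    ∃ C : ℝ≥0∞, C ≠ ∞ ∧ ∀ b > 0, ∫⁻ s in Ici b, ENNReal.ofReal (s ^ (-κ)) ∂μ ≤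
      C * ENNReal.ofReal (b ^ (q - κ)) := by
  obtain ⟨C, hC, hle⟩ := h.exists_setLIntegral_rpow_le κ
  refine ⟨C * ENNReal.ofReal (-(q - κ))⁻¹, by finiteness, fun b hb => ?_⟩
  refine (hle (Ici b) (Ioi b) measurableSet_Ici measurableSet_Ioi
    (fun s hs => hb.trans_le hs) (fun s hs => hb.trans hs)
    fun s hs σ hσ => lt_of_le_of_lt hs hσ.1).trans_eq ?_
  have : q - κ < 0 := by linarith
  have h' : 0 < -(q - κ) := by linarith
  rw [setLIntegral_Ioi_rpow this hb, mul_assoc, ← ENNReal.ofReal_mul (by positivity),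
    mul_comm, div_eq_inv_mul]
  ring_nf

theorem exists_setLIntegral_Icc_le (h : HasPowerTail μ q) :
    ∃ C : ℝ≥0∞, C ≠ ∞ ∧ ∀ b ∈ Ioc (0 : ℝ) 1,
      ∫⁻ s in Icc b 1, ENNReal.ofReal (s ^ (-q)) ∂μ ≤ C * ENNReal.ofReal (Real.log (2 / b)) := by
  obtain ⟨C, hC, hle⟩ := h.exists_setLIntegral_rpow_le q
  refine ⟨C, hC, fun b hb => ?_⟩
  refine (hle (Icc b 1) (Ioo b 2) measurableSet_Icc measurableSet_Ioo
    (fun s hs => hb.1.trans_le hs.1) (fun s hs => hb.1.trans hs.1)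
    fun s hs σ hσ => ⟨lt_of_le_of_lt hs.1 hσ.1, by linarith [hs.2, hσ.2]⟩).trans_eq ?_
  simp only [sub_self, zero_sub]
  rw [setLIntegral_Ioo_rpow_neg_one hb.1 (by linarith [hb.2])]

theorem lintegral_rpow_lt_top (h : HasPowerTail μ q) {κ : ℝ} (hκ : κ < q) :
    ∫⁻ s, ENNReal.ofReal (s ^ (-κ)) ∂μ < ∞ := by
  obtain ⟨C, hC, hle⟩ := h.exists_setLIntegral_Ioo_le hκ
  have h1 := hle 2 two_pos
  have hae : ∀ᵐ s ∂μ, ENNReal.ofReal (s ^ (-κ)) ≤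
      (Ioo (0 : ℝ) 2).indicator (fun s => ENNReal.ofReal (s ^ (-κ))) s +
        ENNReal.ofReal (s ^ |κ|) := by
    filter_upwards [h.pos] with s hs
    by_cases h2 : s < 2
    · rw [indicator_of_mem (show s ∈ Ioo (0 : ℝ) 2 from ⟨hs, h2⟩)]
      exact le_self_add
    · refine le_add_left (ENNReal.ofReal_le_ofReal ?_)
      exact Real.rpow_le_rpow_of_exponent_le (by linarith) (neg_le_abs κ)
  refine (lintegral_mono_ae hae).trans_lt ?_
  rw [lintegral_add_right _ (by fun_prop), lintegral_indicator measurableSet_Ioo]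
  exact ENNReal.add_lt_top.2 ⟨h1.trans_lt (by finiteness), h.moment _ (abs_nonneg κ)⟩

end HasPowerTail

/-- The integral `∫ (s²u² ∧ 1) s^{-α} μ(ds)`: the contribution of a point of norm `u` to the
integral of `|x|² ∧ 1` against the upsilon transform with dilation measure `s^{-α} μ(ds)`. -/
def radialMass (μ : Measure ℝ) (α u : ℝ) : ℝ≥0∞ :=
  ∫⁻ s, ENNReal.ofReal (s ^ (-α)) * ENNReal.ofReal (min (s ^ 2 * u ^ 2) 1) ∂μ

namespace HasPowerTail

variable {μ : Measure ℝ} {q α : ℝ}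

theorem exists_radialMass_le_sq (h : HasPowerTail μ q) (hα : α - 2 < q) :
    ∃ C : ℝ≥0∞, C ≠ ∞ ∧ ∀ u, radialMass μ α u ≤ C * ENNReal.ofReal (u ^ 2) := by
  refine ⟨_, (h.lintegral_rpow_lt_top hα).ne, fun u => ?_⟩
  rw [← lintegral_mul_const _ (by fun_prop)]
  refine lintegral_mono_ae ?_
  filter_upwards [h.pos] with s hs
  rw [← ENNReal.ofReal_mul (by positivity), ← ENNReal.ofReal_mul (by positivity)]
  refine ENNReal.ofReal_le_ofReal ?_
  rw [show -(α - 2) = -α + 2 by ring, Real.rpow_add hs, Real.rpow_two, mul_assoc]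
  gcongr
  exact min_le_left _ _

theorem exists_radialMass_le_const (h : HasPowerTail μ q) (hα : α < q) :
    ∃ C : ℝ≥0∞, C ≠ ∞ ∧ ∀ u, radialMass μ α u ≤ C := by
  refine ⟨_, (h.lintegral_rpow_lt_top hα).ne, fun u => lintegral_mono fun s => ?_⟩
  refine mul_le_of_le_one_right' ?_
  simp

theorem exists_setLIntegral_Ioo_inv_le (h : HasPowerTail μ q) (hα : α - 2 < q) :
    ∃ C : ℝ≥0∞, C ≠ ∞ ∧ ∀ u > 0,
      ∫⁻ s in Ioo 0 u⁻¹, ENNReal.ofReal (s ^ (-α)) * ENNReal.ofReal (min (s ^ 2 * u ^ 2) 1) ∂μ ≤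
        C * ENNReal.ofReal (u ^ (α - q)) := by
  obtain ⟨C, hC, hle⟩ := h.exists_setLIntegral_Ioo_le hα
  refine ⟨C, hC, fun u hu => ?_⟩
  calc _ ≤ ∫⁻ s in Ioo 0 u⁻¹, ENNReal.ofReal (u ^ 2) * ENNReal.ofReal (s ^ (-(α - 2))) ∂μ := by
        refine setLIntegral_mono' measurableSet_Ioo fun s hs => ?_
        have hs := hs.1
        rw [← ENNReal.ofReal_mul (by positivity), ← ENNReal.ofReal_mul (by positivity)]
        refine ENNReal.ofReal_le_ofReal ?_
        rw [show -(α - 2) = -α + 2 by ring, Real.rpow_add hs, Real.rpow_two, mul_left_comm,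
          mul_comm (u ^ 2)]
        gcongr
        exact min_le_left _ _
    _ ≤ ENNReal.ofReal (u ^ 2) * (C * ENNReal.ofReal (u⁻¹ ^ (q - (α - 2)))) := by
        rw [lintegral_const_mul _ (by fun_prop)]
        gcongr
        exact hle _ (inv_pos.2 hu)
    _ = _ := by
        rw [mul_left_comm, ← ENNReal.ofReal_mul (by positivity), Real.inv_rpow hu.le,
          ← Real.rpow_neg hu.le, ← Real.rpow_two, ← Real.rpow_add hu]
        ring_nf

theorem radialMass_eq_add (h : HasPowerTail μ q) {u : ℝ} (hu : 0 < u) :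
    radialMass μ α u =
      ∫⁻ s in Ioo 0 u⁻¹, ENNReal.ofReal (s ^ (-α)) * ENNReal.ofReal (min (s ^ 2 * u ^ 2) 1) ∂μ +
      ∫⁻ s in Ici u⁻¹, ENNReal.ofReal (s ^ (-α)) * ENNReal.ofReal (min (s ^ 2 * u ^ 2) 1) ∂μ := by
  have hae : μ = μ.restrict (Ioi 0) := by
    rw [Measure.restrict_eq_self_of_ae_mem]
    filter_upwards [h.pos] with s hs using hs
  rw [radialMass]
  conv_lhs => rw [hae]
  rw [← Ioo_union_Ici_eq_Ioi (inv_pos.2 hu), lintegral_union measurableSet_Ici]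
  exact disjoint_left.2 fun s hs hs' => (hs.2.trans_le hs').false

theorem exists_radialMass_le_rpow (h : HasPowerTail μ q) (hα : α - 2 < q) (hα' : q < α) :
    ∃ C : ℝ≥0∞, C ≠ ∞ ∧ ∀ u > 0, radialMass μ α u ≤ C * ENNReal.ofReal (u ^ (α - q)) := by
  obtain ⟨C, hC, hle⟩ := h.exists_setLIntegral_Ioo_inv_le hα
  obtain ⟨C', hC', hle'⟩ := h.exists_setLIntegral_Ici_le hα'
  refine ⟨C + C', by finiteness, fun u hu => ?_⟩
  rw [h.radialMass_eq_add hu, add_mul]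
  gcongr
  · exact hle u hu
  · calc _ ≤ ∫⁻ s in Ici u⁻¹, ENNReal.ofReal (s ^ (-α)) ∂μ :=
          lintegral_mono fun s => mul_le_of_le_one_right' (by simp)
      _ ≤ C' * ENNReal.ofReal (u⁻¹ ^ (q - α)) := hle' _ (inv_pos.2 hu)
      _ = _ := by rw [Real.inv_rpow hu.le, ← Real.rpow_neg hu.le, neg_sub]

theorem exists_radialMass_le_log (h : HasPowerTail μ q) :
    ∃ C : ℝ≥0∞, C ≠ ∞ ∧ ∀ u ≥ 1,
      radialMass μ q u ≤ C * (1 + ENNReal.ofReal (Real.log u)) := by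
  obtain ⟨C, hC, hle⟩ := h.exists_setLIntegral_Ioo_inv_le (α := q) (by linarith)
  obtain ⟨C', hC', hle'⟩ := h.exists_setLIntegral_Icc_le
  refine ⟨C + (C' + ∫⁻ s, ENNReal.ofReal (s ^ |q|) ∂μ),
    by finiteness [(h.moment _ (abs_nonneg q)).ne], fun u hu => ?_⟩
  have hu0 : 0 < u := by linarith
  have hu1 : u⁻¹ ∈ Ioc (0 : ℝ) 1 := ⟨inv_pos.2 hu0, inv_le_one_of_one_le₀ hu⟩
  rw [h.radialMass_eq_add hu0, add_mul, add_mul]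
  gcongr
  · refine (hle u hu0).trans ?_
    gcongr
    simp
  · calc _ ≤ ∫⁻ s in Icc u⁻¹ 1 ∪ Ioi 1, ENNReal.ofReal (s ^ (-q)) ∂μ := by
          rw [Icc_union_Ioi_eq_Ici hu1.2]
          exact lintegral_mono fun s => mul_le_of_le_one_right' (by simp)
      _ ≤ ∫⁻ s in Icc u⁻¹ 1, ENNReal.ofReal (s ^ (-q)) ∂μ +
            ∫⁻ s in Ioi 1, ENNReal.ofReal (s ^ (-q)) ∂μ := lintegral_union_le _ _ _
      _ ≤ C' * (1 + ENNReal.ofReal (Real.log u)) +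
            (∫⁻ s, ENNReal.ofReal (s ^ |q|) ∂μ) * (1 + ENNReal.ofReal (Real.log u)) := by
          gcongr
          · refine (hle' _ hu1).trans ?_
            gcongr
            rw [← ENNReal.ofReal_one, ← ENNReal.ofReal_add zero_le_one (Real.log_nonneg hu),
              div_inv_eq_mul, Real.log_mul two_ne_zero hu0.ne']
            refine ENNReal.ofReal_le_ofReal ?_
            linarith [Real.log_two_lt_d9]
          · refine le_mul_of_le_of_one_le ?_ le_self_add
            refine (setLIntegral_mono' measurableSet_Ioi fun s hs => ?_).trans
              (setLIntegral_le_lintegral _ _)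
            exact ENNReal.ofReal_le_ofReal
              (Real.rpow_le_rpow_of_exponent_le (le_of_lt hs) (neg_le_abs q))

theorem exists_rpow_le_radialMass (h : HasPowerTail μ q) :
    ∃ C : ℝ≥0∞, C ≠ ∞ ∧ ∀ u ≥ 1, ENNReal.ofReal (u ^ (α - q)) ≤ C * radialMass μ α u := by
  obtain ⟨K, hK, c, hc, hl⟩ := h.lower
  have hK0 : 0 < K := by linarith
  refine ⟨ENNReal.ofReal (c⁻¹ * K ^ 2 * K ^ |(-α)|), by finiteness, fun u hu => ?_⟩
  have hu0 : 0 < u := by linarith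
  have hu' : 0 < u⁻¹ := inv_pos.2 hu0
  have hu1 : u⁻¹ ∈ Ioc (0 : ℝ) 1 := ⟨hu', inv_le_one_of_one_le₀ hu⟩
  calc ENNReal.ofReal (u ^ (α - q))
      = ENNReal.ofReal (c⁻¹ * u⁻¹ ^ (-α)) * ENNReal.ofReal (c * u⁻¹ ^ q) := by
        rw [← ENNReal.ofReal_mul (by positivity), mul_mul_mul_comm, inv_mul_cancel₀ hc.ne',
          one_mul, ← Real.rpow_add hu', Real.inv_rpow hu0.le, ← Real.rpow_neg hu0.le]
        ring_nf
    _ ≤ ENNReal.ofReal (c⁻¹ * u⁻¹ ^ (-α)) * μ (Ioc (u⁻¹ / K) u⁻¹) := by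
        gcongr
        exact hl _ hu1
    _ = ∫⁻ s in Ioc (u⁻¹ / K) u⁻¹, ENNReal.ofReal (c⁻¹ * u⁻¹ ^ (-α)) ∂μ := by
        rw [setLIntegral_const]
    _ ≤ ∫⁻ s in Ioc (u⁻¹ / K) u⁻¹, ENNReal.ofReal (c⁻¹ * K ^ 2 * K ^ |(-α)|) *
          (ENNReal.ofReal (s ^ (-α)) * ENNReal.ofReal (min (s ^ 2 * u ^ 2) 1)) ∂μ := by
        refine setLIntegral_mono' measurableSet_Ioc fun s hs => ?_
        have hs0 : 0 < s := lt_trans (by positivity) hs.1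
        have hKs : u⁻¹ ≤ K * s := by
          have := (div_lt_iff₀ hK0).1 hs.1
          linarith
        have h1 : 1 ≤ K * (s * u) := by
          have := (inv_le_iff_one_le_mul₀ hu0).1 hKs
          linarith
        have h2 := one_le_sq_mul_min hK.le h1
        rw [← ENNReal.ofReal_mul (by positivity), ← ENNReal.ofReal_mul (by positivity)]
        refine ENNReal.ofReal_le_ofReal ?_
        calc c⁻¹ * u⁻¹ ^ (-α) ≤ c⁻¹ * (K ^ |(-α)| * s ^ (-α)) := by
              gcongr
              exact Real.rpow_le_mul_rpow_of_le_of_le _ hs0 hs.2 hKs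
          _ ≤ c⁻¹ * (K ^ |(-α)| * s ^ (-α)) * (K ^ 2 * min (s ^ 2 * u ^ 2) 1) :=
              le_mul_of_one_le_right (by positivity) h2
          _ = _ := by ring
    _ ≤ _ := by
        rw [lintegral_const_mul _ (by fun_prop)]
        gcongr
        exact setLIntegral_le_lintegral _ _

theorem exists_log_le_radialMass (h : HasPowerTail μ q) :
    ∃ C : ℝ≥0∞, C ≠ ∞ ∧ ∀ u ≥ 1, ENNReal.ofReal (Real.log u) ≤ C * radialMass μ q u := by
  obtain ⟨K, hK, C, hC, hle⟩ := h.exists_setLIntegral_rpow_ge q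
  have hK0 : 0 < K := by linarith
  refine ⟨C * ENNReal.ofReal (K ^ 2), by finiteness, fun u hu => ?_⟩
  have hu0 : 0 < u := by linarith
  have hu' : 0 < u⁻¹ := inv_pos.2 hu0
  have hle := hle (Ioo u⁻¹ 1) (Ioi (u⁻¹ / K)) measurableSet_Ioo measurableSet_Ioi
    (fun s hs => ⟨hu'.trans hs.1, hs.2.le⟩) (fun s hs => lt_trans (div_pos hu' hK0) hs)
    fun s hs σ hσ => lt_trans (div_lt_div_of_pos_right hs.1 hK0) hσ.1
  simp only [sub_self, zero_sub] at hle
  rw [setLIntegral_Ioo_rpow_neg_one hu' (inv_le_one_of_one_le₀ hu), one_div, inv_inv] at hle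
  refine hle.trans ?_
  rw [mul_assoc]
  gcongr
  calc ∫⁻ s in Ioi (u⁻¹ / K), ENNReal.ofReal (s ^ (-q)) ∂μ
      ≤ ∫⁻ s in Ioi (u⁻¹ / K), ENNReal.ofReal (K ^ 2) *
          (ENNReal.ofReal (s ^ (-q)) * ENNReal.ofReal (min (s ^ 2 * u ^ 2) 1)) ∂μ := by
        refine setLIntegral_mono' measurableSet_Ioi fun s hs => ?_
        have hs0 : 0 < s := lt_trans (by positivity) hs
        have h1 : 1 ≤ K * (s * u) := by
          have := (div_lt_iff₀ hK0).1 hs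
          have := (inv_le_iff_one_le_mul₀ hu0).1 this.le
          linarith
        have h2 := one_le_sq_mul_min hK.le h1
        rw [mul_left_comm, ← ENNReal.ofReal_mul (by positivity)]
        exact le_mul_of_one_le_right' (ENNReal.one_le_ofReal.2 h2)
    _ ≤ _ := by
        rw [lintegral_const_mul _ (by fun_prop)]
        gcongr
        exact setLIntegral_le_lintegral _ _

theorem radialMass_eq_top (h : HasPowerTail μ q) (hα : q ≤ α - 2) {u : ℝ} (hu : 0 < u) :
    radialMass μ α u = ∞ := by
  obtain ⟨K, hK, C, hC, hle⟩ := h.exists_setLIntegral_rpow_ge (α - 2)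
  have hK0 : 0 < K := by linarith
  set b := min 1 u⁻¹ with hb
  have hb0 : 0 < b := lt_min one_pos (inv_pos.2 hu)
  have hle := hle (Ioo 0 b) (Ioo 0 b) measurableSet_Ioo measurableSet_Ioo
    (fun s hs => ⟨hs.1, hs.2.le.trans (min_le_left _ _)⟩) Ioo_subset_Ioi_self
    fun s hs σ hσ => ⟨lt_trans (div_pos hs.1 hK0) hσ.1, hσ.2.trans_lt hs.2⟩
  rw [setLIntegral_Ioo_zero_rpow_eq_top (by linarith) hb0, top_le_iff] at hle
  have htop : ∫⁻ s in Ioo 0 b, ENNReal.ofReal (s ^ (-(α - 2))) ∂μ = ∞ := by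
    by_contra hne
    exact (ENNReal.mul_ne_top hC hne) hle
  have hu2 : ENNReal.ofReal (u ^ 2) ≠ 0 := by
    simpa using hu.ne'
  refine top_le_iff.1 ?_
  calc ∞ = ENNReal.ofReal (u ^ 2) * ∫⁻ s in Ioo 0 b, ENNReal.ofReal (s ^ (-(α - 2))) ∂μ := by
        rw [htop, ENNReal.mul_top hu2]
    _ = ∫⁻ s in Ioo 0 b, ENNReal.ofReal (u ^ 2) * ENNReal.ofReal (s ^ (-(α - 2))) ∂μ := by
        rw [lintegral_const_mul _ (by fun_prop)]
    _ = ∫⁻ s in Ioo 0 b,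
          ENNReal.ofReal (s ^ (-α)) * ENNReal.ofReal (min (s ^ 2 * u ^ 2) 1) ∂μ := by
        refine setLIntegral_congr_fun measurableSet_Ioo fun s hs => ?_
        have hs0 := hs.1
        have h1 : s * u ≤ 1 := by
          rw [← le_div_iff₀ hu, one_div]
          exact hs.2.le.trans (min_le_right _ _)
        have h2 : s ^ 2 * u ^ 2 ≤ 1 := by
          rw [← mul_pow]
          exact pow_le_one₀ (by positivity) h1
        simp only [min_eq_left h2]
        rw [← ENNReal.ofReal_mul (by positivity), ← ENNReal.ofReal_mul (by positivity),
          show -(α - 2) = -α + 2 by ring, Real.rpow_add hs0, Real.rpow_two]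
        ring_nf
    _ ≤ _ := setLIntegral_le_lintegral _ _

end HasPowerTail

theorem Real.exp_neg_le_one_sub_half {z : ℝ} (h0 : 0 ≤ z) (h1 : z ≤ 1) :
    Real.exp (-z) ≤ 1 - z / 2 := by
  rw [Real.exp_neg]
  calc (Real.exp z)⁻¹ ≤ (z + 1)⁻¹ := by
        gcongr
        exact Real.add_one_le_exp z
    _ ≤ 1 - z / 2 := by
        rw [inv_le_iff_one_le_mul₀ (by positivity)]
        nlinarith

theorem Real.one_le_two_mul_one_sub_exp_neg {z : ℝ} (h : 1 ≤ z) :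
    1 ≤ 2 * (1 - Real.exp (-z)) := by
  have h1 := Real.exp_neg_le_one_sub_half zero_le_one le_rfl
  have h2 : Real.exp (-z) ≤ Real.exp (-1) := Real.exp_le_exp.2 (by linarith)
  linarith

theorem Real.exp_neg_sub_exp_neg_two_mul_le {y δ : ℝ} (hδ : 0 < δ) (hy : 0 ≤ y) (hyδ : y ≤ δ) :
    Real.exp (-y) - Real.exp (-(2 * y)) ≤ 2 * δ * (1 - Real.exp (-(y / δ))) := by
  have h1 := Real.exp_neg_le_one_sub_half (z := y / δ) (by positivity)
    (div_le_one_of_le₀ hyδ hδ.le)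
  have h2 : Real.exp (-(2 * y)) = Real.exp (-y) ^ 2 := by
    rw [← Real.exp_nat_mul]
    ring_nf
  have h3 : -y + 1 ≤ Real.exp (-y) := Real.add_one_le_exp _
  calc Real.exp (-y) - Real.exp (-(2 * y)) ≤ y := by
        rw [h2]
        nlinarith [sq_nonneg (Real.exp (-y) - 1)]
    _ = 2 * δ * (y / δ / 2) := by
        field_simp
    _ ≤ _ := by
        gcongr
        linarith

theorem Real.rpow_le_exp_neg_sub_exp_neg {r t : ℝ} (hr : 0 ≤ r) (hr1 : r ≤ 1) (ht : 0 ≤ t)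
    (ht1 : t ≤ 1) :
    Real.exp (-2) * (2 ^ r - 1) * t ^ r ≤ Real.exp (-t ^ r) - Real.exp (-(2 * t) ^ r) := by
  rw [Real.mul_rpow zero_le_two ht]
  have h1 : t ^ r ≤ 1 := Real.rpow_le_one ht ht1 hr
  have h2 : (2 : ℝ) ^ r ≤ 2 := by
    simpa using Real.rpow_le_rpow_of_exponent_le one_le_two hr1
  have h3 : (1 : ℝ) ≤ 2 ^ r := Real.one_le_rpow one_le_two hr
  have h0 : 0 ≤ t ^ r := by positivity
  set x := t ^ r
  have h4 : Real.exp (-x) = Real.exp (-(2 ^ r * x)) * Real.exp ((2 ^ r - 1) * x) := by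
    rw [← Real.exp_add]
    ring_nf
  have h5 := Real.add_one_le_exp ((2 ^ r - 1) * x)
  have h6 : Real.exp (-2) ≤ Real.exp (-(2 ^ r * x)) := Real.exp_le_exp.2 (by nlinarith)
  have h7 : 0 ≤ (2 ^ r - 1) * x := mul_nonneg (by linarith) h0
  calc Real.exp (-2) * (2 ^ r - 1) * x ≤ Real.exp (-(2 ^ r * x)) * ((2 ^ r - 1) * x) := by
        rw [mul_assoc]
        gcongr
    _ ≤ Real.exp (-(2 ^ r * x)) * (Real.exp ((2 ^ r - 1) * x) - 1) := by
        gcongr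
        linarith
    _ = _ := by
        rw [mul_sub_one, ← h4]

/-- A measure on `(0, ∞)` such that `s ^ (-p)` has Laplace transform `exp (-t ^ r)`. -/
structure HasStableLaplace (μ : Measure ℝ) (r p : ℝ) : Prop where
  pos : ∀ᵐ s ∂μ, 0 < s
  lintegral_exp : ∀ t : ℝ, 0 ≤ t →
    ∫⁻ s, ENNReal.ofReal (Real.exp (-(t * s ^ (-p)))) ∂μ = ENNReal.ofReal (Real.exp (-(t ^ r)))

namespace HasStableLaplace

variable {μ : Measure ℝ} {r p : ℝ}

theorem isProbabilityMeasure (h : HasStableLaplace μ r p) (hr : 0 < r) :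
    IsProbabilityMeasure μ :=
  ⟨by simpa [hr.ne'] using h.lintegral_exp 0 le_rfl⟩

theorem integrable_exp (h : HasStableLaplace μ r p) {t : ℝ} (ht : 0 ≤ t) :
    Integrable (fun s => Real.exp (-(t * s ^ (-p)))) μ := by
  rw [← lintegral_ofReal_ne_top_iff_integrable (by fun_prop)
    (Filter.Eventually.of_forall fun s => (Real.exp_pos _).le), h.lintegral_exp t ht]
  exact ENNReal.ofReal_ne_top

theorem integral_exp (h : HasStableLaplace μ r p) {t : ℝ} (ht : 0 ≤ t) :
    ∫ s, Real.exp (-(t * s ^ (-p))) ∂μ = Real.exp (-(t ^ r)) := by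
  rw [integral_eq_lintegral_of_nonneg_ae (Filter.Eventually.of_forall fun s => (Real.exp_pos _).le)
    (by fun_prop), h.lintegral_exp t ht, ENNReal.toReal_ofReal (Real.exp_pos _).le]

theorem integral_one_sub_exp_le (h : HasStableLaplace μ r p) (hr : 0 < r) {t : ℝ} (ht : 0 ≤ t) :
    ∫ s, (1 - Real.exp (-(t * s ^ (-p)))) ∂μ ≤ t ^ r := by
  have := h.isProbabilityMeasure hr
  rw [integral_sub (integrable_const _) (h.integrable_exp ht), h.integral_exp ht]
  have := Real.add_one_le_exp (-(t ^ r))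
  simp
  linarith

theorem measure_Iic_le (h : HasStableLaplace μ r p) (hr : 0 < r) (hp : 0 < p) {σ : ℝ}
    (hσ : 0 < σ) : μ (Iic σ) ≤ ENNReal.ofReal (2 * σ ^ (r * p)) := by
  have := h.isProbabilityMeasure hr
  have ht : 0 ≤ σ ^ p := by positivity
  rw [← ofReal_measureReal]
  refine ENNReal.ofReal_le_ofReal ?_
  calc μ.real (Iic σ) = ∫ s, (Iic σ).indicator 1 s ∂μ := by
        rw [integral_indicator_one measurableSet_Iic]
    _ ≤ ∫ s, 2 * (1 - Real.exp (-(σ ^ p * s ^ (-p)))) ∂μ := by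
        refine integral_mono_ae ((integrable_const (1 : ℝ)).indicator measurableSet_Iic)
          (((integrable_const _).sub (h.integrable_exp ht)).const_mul _) ?_
        filter_upwards [h.pos] with s hs
        by_cases hsσ : s ≤ σ
        · rw [indicator_of_mem (show s ∈ Iic σ from hsσ)]
          refine Real.one_le_two_mul_one_sub_exp_neg ?_
          rw [Real.rpow_neg hs.le, ← div_eq_mul_inv, one_le_div (by positivity)]
          exact Real.rpow_le_rpow hs.le hsσ hp.le
        · rw [indicator_of_notMem (show s ∉ Iic σ from hsσ)]
          have : Real.exp (-(σ ^ p * s ^ (-p))) ≤ 1 :=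
            Real.exp_le_one_iff.2 (neg_nonpos.2 (by positivity))
          linarith
    _ ≤ 2 * (σ ^ p) ^ r := by
        rw [integral_const_mul]
        gcongr
        exact h.integral_one_sub_exp_le hr ht
    _ = _ := by rw [← Real.rpow_mul hσ.le, mul_comm p]

theorem le_measureReal_Ioc (h : HasStableLaplace μ r p) (hr : 0 < r) (hr1 : r < 1) (hp : 0 < p)
    {δ L σ : ℝ} (hδ : 0 < δ) (hδ1 : δ ≤ 1) (hL : 0 < L) (hσ : 0 < σ) (hσ1 : σ ≤ 1) :
    Real.exp (-2) * (2 ^ r - 1) * (δ * σ ^ p) ^ r ≤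
      2 * δ * (σ ^ p) ^ r + 2 * (δ * σ ^ p / L) ^ r +
        μ.real (Ioc (σ / (L / δ) ^ p⁻¹) σ) := by
  have := h.isProbabilityMeasure hr
  have hσp : 0 ≤ σ ^ p := by positivity
  set t := δ * σ ^ p with ht
  set A := Ioc (σ / (L / δ) ^ p⁻¹) σ with hA
  have ht0 : 0 ≤ t := by positivity
  have ht1 : t ≤ 1 := mul_le_one₀ hδ1 hσp (Real.rpow_le_one hσ.le hσ1 hp.le)
  have hI1 := h.integrable_exp ht0
  have hI2 := h.integrable_exp (mul_nonneg zero_le_two ht0)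
  have hI3 : Integrable (fun s => 2 * δ * (1 - Real.exp (-(σ ^ p * s ^ (-p))))) μ :=
    ((integrable_const (1 : ℝ)).sub (h.integrable_exp hσp)).const_mul (2 * δ)
  have hI4 : Integrable (fun s => 2 * (1 - Real.exp (-(t / L * s ^ (-p))))) μ :=
    ((integrable_const (1 : ℝ)).sub (h.integrable_exp (div_nonneg ht0 hL.le))).const_mul 2
  have hI34 : Integrable (fun s => 2 * δ * (1 - Real.exp (-(σ ^ p * s ^ (-p)))) +
      2 * (1 - Real.exp (-(t / L * s ^ (-p))))) μ := hI3.add hI4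
  have hI5 : Integrable (A.indicator (1 : ℝ → ℝ)) μ :=
    (integrable_const (1 : ℝ)).indicator measurableSet_Ioc
  calc _ ≤ Real.exp (-t ^ r) - Real.exp (-(2 * t) ^ r) :=
        Real.rpow_le_exp_neg_sub_exp_neg hr.le hr1.le ht0 ht1
    _ = ∫ s, (Real.exp (-(t * s ^ (-p))) - Real.exp (-(2 * t * s ^ (-p)))) ∂μ := by
        rw [integral_sub hI1 hI2, h.integral_exp ht0, h.integral_exp (by positivity)]
    _ ≤ ∫ s, (2 * δ * (1 - Real.exp (-(σ ^ p * s ^ (-p)))) +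
          2 * (1 - Real.exp (-(t / L * s ^ (-p)))) + A.indicator 1 s) ∂μ := by
        refine integral_mono_ae (hI1.sub hI2) (hI34.add hI5) ?_
        filter_upwards [h.pos] with s hs
        have hsp : 0 < s ^ (-p) := by positivity
        have hy : 0 ≤ t * s ^ (-p) := by positivity
        have h1 : Real.exp (-(σ ^ p * s ^ (-p))) ≤ 1 :=
          Real.exp_le_one_iff.2 (neg_nonpos.2 (by positivity))
        have h2 : Real.exp (-(t / L * s ^ (-p))) ≤ 1 :=
          Real.exp_le_one_iff.2 (neg_nonpos.2 (by positivity))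
        have h3 : 0 ≤ A.indicator (1 : ℝ → ℝ) s := indicator_nonneg (fun _ _ => zero_le_one) s
        have h4 : Real.exp (-(t * s ^ (-p))) ≤ 1 := Real.exp_le_one_iff.2 (neg_nonpos.2 hy)
        have h5 := Real.exp_pos (-(2 * t * s ^ (-p)))
        have h6 : 0 ≤ 2 * δ * (1 - Real.exp (-(σ ^ p * s ^ (-p)))) :=
          mul_nonneg (by positivity) (by linarith)
        rcases lt_or_ge σ s with hσs | hσs
        · have hyδ : t * s ^ (-p) ≤ δ := by
            rw [ht, mul_assoc, Real.rpow_neg hs.le, ← div_eq_mul_inv]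
            exact mul_le_of_le_one_right hδ.le
              (div_le_one_of_le₀ (Real.rpow_le_rpow hσ.le hσs.le hp.le) (by positivity))
          have := Real.exp_neg_sub_exp_neg_two_mul_le hδ hy hyδ
          rw [show t * s ^ (-p) / δ = σ ^ p * s ^ (-p) by rw [ht]; field_simp,
            ← mul_assoc 2 t] at this
          linarith
        · rcases le_or_gt s (σ / (L / δ) ^ p⁻¹) with hsσ | hsσ
          · have hyL : 1 ≤ t / L * s ^ (-p) := by
              have h7 : (L / δ) ^ p⁻¹ * s ≤ σ := by
                rw [mul_comm]
                exact (le_div_iff₀ (by positivity)).1 hsσ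
              have h8 := Real.rpow_le_rpow (by positivity) h7 hp.le
              rw [Real.mul_rpow (by positivity) hs.le, ← Real.rpow_mul (by positivity),
                inv_mul_cancel₀ hp.ne', Real.rpow_one] at h8
              rw [Real.rpow_neg hs.le, ← div_eq_mul_inv, one_le_div (by positivity),
                le_div_iff₀ hL, ht]
              rw [div_mul_eq_mul_div, div_le_iff₀ hδ] at h8
              linarith
            have := Real.one_le_two_mul_one_sub_exp_neg hyL
            linarith
          · have : A.indicator (1 : ℝ → ℝ) s = 1 :=
              indicator_of_mem (show s ∈ A from ⟨hsσ, hσs⟩) _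
            linarith
    _ = 2 * δ * ∫ s, (1 - Real.exp (-(σ ^ p * s ^ (-p)))) ∂μ +
          2 * ∫ s, (1 - Real.exp (-(t / L * s ^ (-p)))) ∂μ + μ.real A := by
        rw [integral_add hI34 hI5, integral_add hI3 hI4, integral_const_mul,
          integral_const_mul, integral_indicator_one measurableSet_Ioc]
    _ ≤ _ := by
        gcongr
        · exact h.integral_one_sub_exp_le hr hσp
        · exact h.integral_one_sub_exp_le hr (by positivity)

theorem exists_le_measure_Ioc (h : HasStableLaplace μ r p) (hr : 0 < r) (hr1 : r < 1)
    (hp : 0 < p) : ∃ K > 1, ∃ c > 0, ∀ σ ∈ Ioc (0 : ℝ) 1,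
      ENNReal.ofReal (c * σ ^ (r * p)) ≤ μ (Ioc (σ / K) σ) := by
  have := h.isProbabilityMeasure hr
  set a := Real.exp (-2) * (2 ^ r - 1) / 8 with ha
  have h2r : (1 : ℝ) < 2 ^ r := Real.one_lt_rpow one_lt_two hr
  have h2r' : (2 : ℝ) ^ r ≤ 2 := by
    simpa using Real.rpow_le_rpow_of_exponent_le one_le_two hr1.le
  have he : Real.exp (-2) < 1 := Real.exp_lt_one_iff.2 (by norm_num)
  have he0 := Real.exp_pos (-2)
  have ha0 : 0 < a := by
    have : (0 : ℝ) < 2 ^ r - 1 := by linarith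
    positivity
  have ha1 : a < 1 := by
    rw [ha]
    nlinarith
  set δ := a ^ (1 - r)⁻¹ with hδ
  set L := a ^ (-r⁻¹) with hL
  have hr' : 0 < 1 - r := by linarith
  have hδ0 : 0 < δ := by positivity
  have hL0 : 0 < L := by positivity
  have hδ1 : δ < 1 := Real.rpow_lt_one ha0.le ha1 (by positivity)
  have hL1 : 1 < L := Real.one_lt_rpow_of_pos_of_lt_one_of_neg ha0 ha1 (by simpa using hr)
  have hδr : δ = a * δ ^ r := by
    have : δ ^ (1 - r) = a := by
      rw [hδ, ← Real.rpow_mul ha0.le, inv_mul_cancel₀ hr'.ne', Real.rpow_one]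
    rw [← this, ← Real.rpow_add hδ0, sub_add_cancel, Real.rpow_one]
  have hLr : L ^ r = a⁻¹ := by
    rw [hL, ← Real.rpow_mul ha0.le, neg_mul, inv_mul_cancel₀ hr.ne', Real.rpow_neg_one]
  refine ⟨(L / δ) ^ p⁻¹, Real.one_lt_rpow ((one_lt_div hδ0).2 (by linarith)) (by positivity),
    4 * a * δ ^ r, by positivity, fun σ hσ => ?_⟩
  have hσ0 := hσ.1
  rw [← ofReal_measureReal]
  refine ENNReal.ofReal_le_ofReal ?_
  have key := h.le_measureReal_Ioc hr hr1 hp hδ0 hδ1.le hL0 hσ.1 hσ.2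
  rw [Real.div_rpow (by positivity) hL0.le, Real.mul_rpow hδ0.le (by positivity), hLr,
    div_inv_eq_mul, ← Real.rpow_mul hσ0.le, mul_comm p,
    show Real.exp (-2) * (2 ^ r - 1) = 8 * a by rw [ha]; ring] at key
  have h9 : 2 * δ * σ ^ (r * p) = 2 * (a * δ ^ r) * σ ^ (r * p) := by rw [← hδr]
  rw [h9] at key
  linarith

theorem lintegral_rpow_lt_top (h : HasStableLaplace μ r p) (hr : 0 < r) (hp : 0 < p) {k : ℝ}
    (hk : 0 ≤ k) : ∫⁻ s, ENNReal.ofReal (s ^ k) ∂μ < ∞ := by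
  have := h.isProbabilityMeasure hr
  rcases hk.eq_or_lt with rfl | hk
  · simp
  have ha : 0 < k / p := by positivity
  have hΓ := Real.Gamma_pos_of_pos ha
  set g : ℝ → ℝ → ℝ≥0∞ := fun s t =>
    ENNReal.ofReal (t ^ (k / p - 1)) * ENNReal.ofReal (Real.exp (-(t * s ^ (-p)))) with hg
  have hgm : Measurable (Function.uncurry g) := by
    simp only [hg, Function.uncurry_def]
    fun_prop
  have h1 : ∫⁻ s, (∫⁻ t in Ioi 0, g s t) ∂μ =
      (∫⁻ s, ENNReal.ofReal (s ^ k) ∂μ) * ENNReal.ofReal (Real.Gamma (k / p)) := by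
    rw [← lintegral_mul_const _ (by fun_prop)]
    refine lintegral_congr_ae ?_
    filter_upwards [h.pos] with s hs
    have hsp : 0 < s ^ (-p) := by positivity
    have hint := Real.integral_rpow_mul_exp_neg_mul_Ioi ha hsp
    have hval : (1 / s ^ (-p)) ^ (k / p) = s ^ k := by
      rw [one_div, Real.rpow_neg hs.le, inv_inv, ← Real.rpow_mul hs.le, mul_div_cancel₀ _ hp.ne']
    rw [hval] at hint
    rw [← ENNReal.ofReal_mul (by positivity), ← hint, ofReal_integral_eq_lintegral_ofReal]
    · refine setLIntegral_congr_fun measurableSet_Ioi fun t ht => ?_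
      have ht : 0 < t := ht
      simp only [hg]
      rw [← ENNReal.ofReal_mul (by positivity), mul_comm t]
    · refine Integrable.of_integral_ne_zero ?_
      rw [hint]
      positivity
    · filter_upwards [ae_restrict_mem measurableSet_Ioi] with t ht
      have ht : 0 < t := ht
      positivity
  have h2 : ∫⁻ s, (∫⁻ t in Ioi 0, g s t) ∂μ < ∞ := by
    rw [lintegral_lintegral_swap hgm.aemeasurable]
    calc ∫⁻ t in Ioi 0, (∫⁻ s, g s t ∂μ)
        = ∫⁻ t in Ioi 0, ENNReal.ofReal (t ^ (k / p - 1) * Real.exp (-(t ^ r))) := by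
          refine setLIntegral_congr_fun measurableSet_Ioi fun t ht => ?_
          have ht : 0 < t := ht
          simp only [hg]
          rw [lintegral_const_mul _ (by fun_prop), h.lintegral_exp t ht.le,
            ← ENNReal.ofReal_mul (by positivity)]
      _ < ∞ := (integrableOn_rpow_mul_exp_neg_rpow (by linarith) hr).lintegral_lt_top
  rw [h1] at h2
  by_contra htop
  rw [not_lt, top_le_iff] at htop
  rw [htop, ENNReal.top_mul (by simpa using hΓ)] at h2
  exact h2.ne rfl

theorem hasPowerTail (h : HasStableLaplace μ r p) (hr : 0 < r) (hr1 : r < 1) (hp : 0 < p) :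
    HasPowerTail μ (r * p) where
  pos := h.pos
  upper := ⟨2, fun _ hσ => h.measure_Iic_le hr hp hσ⟩
  lower := h.exists_le_measure_Ioc hr hr1 hp
  moment _ hk := h.lintegral_rpow_lt_top hr hp hk

end HasStableLaplace

theorem IsStableDensity.integrableOn {r : ℝ} {f : ℝ → ℝ} (hf : IsStableDensity r f) {t : ℝ}
    (ht : 0 ≤ t) : IntegrableOn (fun x => Real.exp (-(t * x)) * f x) (Ioi 0) := by
  refine Integrable.of_integral_ne_zero ?_
  rw [hf.2.2 t ht]
  exact (Real.exp_pos _).ne'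

theorem ae_piMeasure_pos (f : ℝ → ℝ) (α p : ℝ) : ∀ᵐ s ∂piMeasure f α p, 0 < s := by
  rw [ae_iff, piMeasure, withDensity_apply _ (by measurability)]
  refine setLIntegral_eq_zero (by measurability) fun s hs => ?_
  exact if_neg hs

theorem measurable_piMeasure_density {f : ℝ → ℝ} (hf : Measurable f) (α p : ℝ) :
    Measurable fun s : ℝ =>
      if 0 < s then ENNReal.ofReal (p * f (s ^ (-p)) * s ^ (-α - p - 1)) else 0 :=
  Measurable.ite measurableSet_Ioi (by fun_prop) measurable_const

theorem lintegral_piMeasure_eq_setLIntegral {f : ℝ → ℝ} (hf : Measurable f) (α p : ℝ)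
    {g : ℝ → ℝ≥0∞} (hg : Measurable g) :
    ∫⁻ s, g s ∂piMeasure f α p =
      ∫⁻ s in Ioi 0, ENNReal.ofReal (p * f (s ^ (-p)) * s ^ (-α - p - 1)) * g s := by
  rw [piMeasure, lintegral_withDensity_eq_lintegral_mul _ (measurable_piMeasure_density hf α p) hg,
    ← lintegral_indicator measurableSet_Ioi]
  refine lintegral_congr fun s => ?_
  by_cases hs : 0 < s <;> simp [hs]

theorem lintegral_piMeasure {f : ℝ → ℝ} (hf : Measurable f) (α p : ℝ)
    {g : ℝ → ℝ≥0∞} (hg : Measurable g) :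
    ∫⁻ s, g s ∂piMeasure f α p = ∫⁻ s, ENNReal.ofReal (s ^ (-α)) * g s ∂piMeasure f 0 p := by
  rw [lintegral_piMeasure_eq_setLIntegral hf α p hg,
    lintegral_piMeasure_eq_setLIntegral hf 0 p (by fun_prop)]
  refine setLIntegral_congr_fun measurableSet_Ioi fun s (hs : 0 < s) => ?_
  have hs0 : 0 ≤ s ^ (-α) := by positivity
  rw [← mul_assoc, ← ENNReal.ofReal_mul' hs0, mul_assoc _ _ (s ^ (-α)), ← Real.rpow_add hs]
  ring_nf

theorem IsStableDensity.hasStableLaplace {r p : ℝ} {f : ℝ → ℝ} (hf : IsStableDensity r f)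
    (hp : 0 < p) : HasStableLaplace (piMeasure f 0 p) r p where
  pos := ae_piMeasure_pos f 0 p
  lintegral_exp t ht := by
    set g : ℝ → ℝ := fun x => Real.exp (-(t * x)) * f x with hg
    have hint : IntegrableOn (fun s => (|-p| * s ^ (-p - 1)) • g (s ^ (-p))) (Ioi 0) :=
      (integrableOn_Ioi_comp_rpow_iff g (neg_ne_zero.2 hp.ne')).2 (hf.integrableOn ht)
    rw [lintegral_piMeasure_eq_setLIntegral hf.1 0 p (by fun_prop), ← hf.2.2 t ht,
      ← integral_comp_rpow_Ioi g (neg_ne_zero.2 hp.ne'),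
      ofReal_integral_eq_lintegral_ofReal hint]
    · refine setLIntegral_congr_fun measurableSet_Ioi fun s (hs : 0 < s) => ?_
      rw [← ENNReal.ofReal_mul' (Real.exp_pos _).le, abs_neg, abs_of_pos hp, hg, smul_eq_mul]
      ring_nf
    · filter_upwards [ae_restrict_mem measurableSet_Ioi] with s (hs : 0 < s)
      have := hf.2.1 (s ^ (-p))
      positivity

theorem IsStableDensity.hasPowerTail {p q : ℝ} {f : ℝ → ℝ} (hq : 0 < q) (hqp : q < p)
    (hf : IsStableDensity (q / p) f) : HasPowerTail (piMeasure f 0 p) q := by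
  have hp := hq.trans hqp
  simpa [div_mul_cancel₀ q hp.ne'] using
    (hf.hasStableLaplace hp).hasPowerTail (div_pos hq hp) ((div_lt_one hp).2 hqp) hp

theorem lintegral_piMeasure_eq_radialMass {f : ℝ → ℝ} (hf : Measurable f) (α p u : ℝ) :
    ∫⁻ s, ENNReal.ofReal (min (s ^ 2 * u ^ 2) 1) ∂piMeasure f α p =
      radialMass (piMeasure f 0 p) α u :=
  lintegral_piMeasure hf α p (by fun_prop)

theorem sigmaFinite_of_lintegral_lt_top {X : Type*} [MeasurableSpace X] {μ : Measure X}
    {g : X → ℝ≥0∞} (hg : Measurable g) (h0 : μ {x | g x = 0} = 0) (h : ∫⁻ x, g x ∂μ < ∞) :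
    SigmaFinite μ := by
  refine (Measure.FiniteSpanningSetsIn.mk (C := univ)
    (fun n : ℕ => {x | ((n : ℝ≥0∞) + 1)⁻¹ ≤ g x} ∪ {x | g x = 0}) (fun _ => trivial)
    (fun n => ?_) ?_).sigmaFinite
  · refine (measure_union_le _ _).trans_lt ?_
    rw [h0, add_zero]
    exact (meas_ge_le_lintegral_div hg.aemeasurable (by simp) (by simp)).trans_lt
      (ENNReal.div_lt_top h.ne (by simp))
  · refine eq_univ_of_forall fun x => ?_
    rcases eq_or_ne (g x) 0 with hx | hx
    · exact mem_iUnion.2 ⟨0, Or.inr hx⟩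
    · obtain ⟨n, hn⟩ := ENNReal.exists_inv_nat_lt hx
      refine mem_iUnion.2 ⟨n, Or.inl (le_trans ?_ hn.le)⟩
      exact ENNReal.inv_le_inv.2 le_self_add

omit [NormedSpace ℝ E] [BorelSpace E] in
theorem isLevyMeasure_zero : IsLevyMeasure (0 : Measure E) :=
  ⟨inferInstance, by simp, by simp⟩

omit [NormedSpace ℝ E] in
theorem IsLevyMeasure.of_lintegral_lt_top {M : Measure E} (h0 : M {0} = 0)
    (h : ∫⁻ x, ENNReal.ofReal (min (‖x‖ ^ 2) 1) ∂M < ∞) : IsLevyMeasure M := by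
  refine ⟨sigmaFinite_of_lintegral_lt_top (by fun_prop) ?_ h, h0, h⟩
  convert h0 using 2
  ext x
  simp

omit [NormedSpace ℝ E] in
theorem IsLevyMeasure.measure_one_le_norm_lt_top {M : Measure E} (hM : IsLevyMeasure M) :
    M {x | 1 ≤ ‖x‖} < ∞ := by
  refine lt_of_le_of_lt ?_ hM.2.2
  rw [← setLIntegral_one]
  refine (setLIntegral_mono' (measurableSet_le measurable_const measurable_norm)
    fun x (hx : 1 ≤ ‖x‖) => ?_).trans (setLIntegral_le_lintegral _ _)
  rw [min_eq_right (one_le_pow₀ hx), ENNReal.ofReal_one]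

theorem isLevyMeasure_Upsilon_iff [SecondCountableTopology E] {M : Measure E}
    (hM : IsLevyMeasure M) {f : ℝ → ℝ} (hf : Measurable f) (α p : ℝ) :
    IsLevyMeasure (Upsilon (piMeasure f α p) M) ↔
      ∫⁻ x, radialMass (piMeasure f 0 p) α ‖x‖ ∂M < ∞ := by
  have := hM.1
  have : SFinite (piMeasure f α p) := by
    unfold piMeasure
    infer_instance
  have hsm : Measurable fun sx : ℝ × E => sx.1 • sx.2 := by fun_prop
  have h0 : Upsilon (piMeasure f α p) M {0} = 0 := by
    rw [Upsilon, Measure.map_apply hsm (measurableSet_singleton 0),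
      Measure.measure_prod_null (hsm (measurableSet_singleton 0))]
    filter_upwards [ae_piMeasure_pos f α p] with s hs
    have : Prod.mk s ⁻¹' ((fun sx : ℝ × E => sx.1 • sx.2) ⁻¹' {0}) = {0} := by
      ext x
      simp [hs.ne']
    simp [this, hM.2.1]
  have h : ∫⁻ x, ENNReal.ofReal (min (‖x‖ ^ 2) 1) ∂Upsilon (piMeasure f α p) M =
      ∫⁻ x, radialMass (piMeasure f 0 p) α ‖x‖ ∂M := by
    rw [Upsilon, lintegral_map (by fun_prop) hsm, lintegral_prod_symm _ (by fun_prop)]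
    refine lintegral_congr fun x => ?_
    rw [← lintegral_piMeasure_eq_radialMass hf]
    refine lintegral_congr fun s => ?_
    simp [norm_smul, mul_pow]
  rw [← h]
  exact ⟨fun h => h.2.2, IsLevyMeasure.of_lintegral_lt_top h0⟩

omit [NormedSpace ℝ E] in
theorem lintegral_radialMass_lt_top_of_le {μ : Measure ℝ} {α : ℝ} {C D : ℝ≥0∞}
    (hC : C ≠ ∞) (hD : D ≠ ∞) (hsq : ∀ u, radialMass μ α u ≤ C * ENNReal.ofReal (u ^ 2))
    {φ : ℝ → ℝ} (hφm : Measurable φ) (hφ : ∀ u ≥ 1, radialMass μ α u ≤ D * ENNReal.ofReal (φ u))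
    {M : Measure E} (hM : ∫⁻ x, ENNReal.ofReal (min (‖x‖ ^ 2) (φ ‖x‖)) ∂M < ∞)
    (hφ1 : ∀ u, 0 ≤ u → u ≤ 1 → u ^ 2 ≤ φ u) (hφ2 : ∀ u ≥ 1, φ u ≤ u ^ 2) :
    ∫⁻ x, radialMass μ α ‖x‖ ∂M < ∞ := by
  calc ∫⁻ x, radialMass μ α ‖x‖ ∂M
      ≤ ∫⁻ x, (C + D) * ENNReal.ofReal (min (‖x‖ ^ 2) (φ ‖x‖)) ∂M := by
        refine lintegral_mono fun x => ?_
        rcases le_total ‖x‖ 1 with hx | hx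
        · rw [min_eq_left (hφ1 _ (norm_nonneg x) hx)]
          refine (hsq _).trans ?_
          gcongr
          exact le_self_add
        · rw [min_eq_right (hφ2 _ hx)]
          refine (hφ _ hx).trans ?_
          gcongr
          exact le_add_self
    _ = (C + D) * ∫⁻ x, ENNReal.ofReal (min (‖x‖ ^ 2) (φ ‖x‖)) ∂M :=
        lintegral_const_mul _ (by fun_prop)
    _ < ∞ := ENNReal.mul_lt_top (by finiteness) hM

namespace HasPowerTail

variable {μ : Measure ℝ} {α q : ℝ} {M : Measure E}

omit [NormedSpace ℝ E] in
theorem lintegral_radialMass_lt_top_of_lt (h : HasPowerTail μ q) (hα : α < q)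
    (hM : IsLevyMeasure M) : ∫⁻ x, radialMass μ α ‖x‖ ∂M < ∞ := by
  obtain ⟨C, hC, hC'⟩ := h.exists_radialMass_le_sq (α := α) (by linarith)
  obtain ⟨D, hD, hD'⟩ := h.exists_radialMass_le_const hα
  exact lintegral_radialMass_lt_top_of_le hC hD hC' (φ := fun _ => 1) measurable_const
    (fun u _ => by simpa using hD' u) hM.2.2 (fun u h0 h1 => pow_le_one₀ h0 h1)
    fun u hu => one_le_pow₀ hu

omit [NormedSpace ℝ E] in
theorem lintegral_radialMass_lt_top_iff_log (h : HasPowerTail μ q) (hM : IsLevyMeasure M) :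
    ∫⁻ x, radialMass μ q ‖x‖ ∂M < ∞ ↔
      ∫⁻ x in {x : E | 1 < ‖x‖}, ENNReal.ofReal (Real.log ‖x‖) ∂M < ∞ := by
  have hS : MeasurableSet {x : E | 1 < ‖x‖} := measurableSet_lt measurable_const measurable_norm
  constructor
  · intro hfin
    obtain ⟨C, hC, hC'⟩ := h.exists_log_le_radialMass
    calc _ ≤ ∫⁻ x in {x : E | 1 < ‖x‖}, C * radialMass μ q ‖x‖ ∂M :=
          setLIntegral_mono' hS fun x hx => hC' _ (le_of_lt hx)
      _ ≤ ∫⁻ x, C * radialMass μ q ‖x‖ ∂M := setLIntegral_le_lintegral _ _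
      _ = C * ∫⁻ x, radialMass μ q ‖x‖ ∂M := lintegral_const_mul' _ _ hC
      _ < ∞ := ENNReal.mul_lt_top hC.lt_top hfin
  · intro hfin
    obtain ⟨C, hC, hC'⟩ := h.exists_radialMass_le_sq (α := q) (by linarith)
    obtain ⟨D, hD, hD'⟩ := h.exists_radialMass_le_log
    rw [← lintegral_add_compl _ hS]
    refine ENNReal.add_lt_top.2 ⟨?_, ?_⟩
    · calc _ ≤ ∫⁻ x in {x : E | 1 < ‖x‖}, D * (1 + ENNReal.ofReal (Real.log ‖x‖)) ∂M :=
            setLIntegral_mono' hS fun x hx => hD' _ (le_of_lt hx)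
        _ = D * (M {x : E | 1 < ‖x‖} +
              ∫⁻ x in {x : E | 1 < ‖x‖}, ENNReal.ofReal (Real.log ‖x‖) ∂M) := by
            rw [lintegral_const_mul' _ _ hD, lintegral_add_left measurable_const, setLIntegral_one]
        _ < ∞ := ENNReal.mul_lt_top hD.lt_top (ENNReal.add_lt_top.2
            ⟨(measure_mono fun x (hx : 1 < ‖x‖) => hx.le).trans_lt hM.measure_one_le_norm_lt_top, hfin⟩)
    · calc _ ≤ ∫⁻ x in {x : E | 1 < ‖x‖}ᶜ, C * ENNReal.ofReal (min (‖x‖ ^ 2) 1) ∂M := by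
            refine setLIntegral_mono' hS.compl fun x hx => ?_
            rw [min_eq_left (pow_le_one₀ (norm_nonneg x) (not_lt.1 hx))]
            exact hC' _
        _ ≤ ∫⁻ x, C * ENNReal.ofReal (min (‖x‖ ^ 2) 1) ∂M := setLIntegral_le_lintegral _ _
        _ = C * ∫⁻ x, ENNReal.ofReal (min (‖x‖ ^ 2) 1) ∂M := lintegral_const_mul' _ _ hC
        _ < ∞ := ENNReal.mul_lt_top hC.lt_top hM.2.2

omit [NormedSpace ℝ E] in
theorem lintegral_radialMass_lt_top_of_memMAlpha (h : HasPowerTail μ q) (hα : q < α)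
    (hα' : α - q < 2) (hM : MemMAlpha (α - q) M) : ∫⁻ x, radialMass μ α ‖x‖ ∂M < ∞ := by
  obtain ⟨C, hC, hC'⟩ := h.exists_radialMass_le_sq (α := α) (by linarith)
  obtain ⟨D, hD, hD'⟩ := h.exists_radialMass_le_rpow (by linarith) hα
  refine lintegral_radialMass_lt_top_of_le hC hD hC' (φ := fun u => u ^ (α - q))
    (by fun_prop) (fun u hu => hD' u (by linarith)) hM.2 (fun u h0 h1 => ?_) fun u hu => ?_
  · rw [← Real.rpow_two]
    exact Real.rpow_le_rpow_of_exponent_ge' h0 h1 (by linarith) hα'.le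
  · rw [← Real.rpow_two]
    exact Real.rpow_le_rpow_of_exponent_le hu hα'.le

omit [NormedSpace ℝ E] in
theorem memMAlpha_of_lintegral_radialMass_lt_top (h : HasPowerTail μ q) (hM : IsLevyMeasure M)
    (hfin : ∫⁻ x, radialMass μ α ‖x‖ ∂M < ∞) : MemMAlpha (α - q) M := by
  refine ⟨hM.2.1, ?_⟩
  obtain ⟨C, hC, hC'⟩ := h.exists_rpow_le_radialMass (α := α)
  calc _ ≤ ∫⁻ x, (ENNReal.ofReal (min (‖x‖ ^ 2) 1) + C * radialMass μ α ‖x‖) ∂M := by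
        refine lintegral_mono fun x => ?_
        rcases le_total ‖x‖ 1 with hx | hx
        · rw [min_eq_left (pow_le_one₀ (norm_nonneg x) hx)]
          exact le_add_right (ENNReal.ofReal_le_ofReal (min_le_left _ _))
        · exact le_add_left ((ENNReal.ofReal_le_ofReal (min_le_right _ _)).trans (hC' _ hx))
    _ = ∫⁻ x, ENNReal.ofReal (min (‖x‖ ^ 2) 1) ∂M + C * ∫⁻ x, radialMass μ α ‖x‖ ∂M := by
        rw [lintegral_add_left (by fun_prop), lintegral_const_mul' _ _ hC]
    _ < ∞ := ENNReal.add_lt_top.2 ⟨hM.2.2, ENNReal.mul_lt_top hC.lt_top hfin⟩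

omit [NormedSpace ℝ E] in
theorem eq_zero_of_lintegral_radialMass_lt_top (h : HasPowerTail μ q) (hα : q ≤ α - 2)
    (hM : IsLevyMeasure M) (hfin : ∫⁻ x, radialMass μ α ‖x‖ ∂M < ∞) : M = 0 := by
  have hc : M {0}ᶜ = 0 := by
    by_contra hne
    refine hfin.ne (top_unique ?_)
    calc ∞ = ∞ * M {0}ᶜ := (ENNReal.top_mul hne).symm
      _ = ∫⁻ _ in {0}ᶜ, ∞ ∂M := (setLIntegral_const _ _).symm
      _ ≤ ∫⁻ x in {0}ᶜ, radialMass μ α ‖x‖ ∂M :=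
          setLIntegral_mono' (measurableSet_singleton 0).compl fun x hx =>
            (h.radialMass_eq_top hα (norm_pos_iff.2 hx)).ge
      _ ≤ _ := setLIntegral_le_lintegral _ _
  rw [← Measure.measure_univ_eq_zero, ← union_compl_self {0}]
  exact measure_union_null hM.2.1 hc

end HasPowerTail

omit [NormedSpace ℝ E] in
theorem MemMAlpha.isLevyMeasure {β : ℝ} (hβ : 0 < β) (hβ2 : β < 2) {M : Measure E}
    (hM : MemMAlpha β M) : IsLevyMeasure M := by
  refine .of_lintegral_lt_top hM.1 ((lintegral_mono fun x => ?_).trans_lt hM.2)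
  refine ENNReal.ofReal_le_ofReal (le_min (min_le_left _ _) ?_)
  rcases le_total ‖x‖ 1 with hx | hx
  · refine (min_le_left _ _).trans ?_
    rw [← Real.rpow_two]
    exact Real.rpow_le_rpow_of_exponent_ge' (norm_nonneg x) hx hβ.le hβ2.le
  · exact (min_le_right _ _).trans (Real.one_le_rpow hx hβ.le)

theorem stmt2 (d : ℕ) (hd : 1 ≤ d) (α q p : ℝ) (hq : 0 < q) (hqp : q < p)
    (f : ℝ → ℝ) (hf : IsStableDensity (q / p) f) :
    (α - q < 0 →
      UpsilonDomain (E := EuclideanSpace ℝ (Fin d)) (piMeasure f α p) =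
        {M | IsLevyMeasure M}) ∧
    (α - q = 0 →
      UpsilonDomain (E := EuclideanSpace ℝ (Fin d)) (piMeasure f α p) =
        {M | MemMLog M}) ∧
    (0 < α - q → α - q < 2 →
      UpsilonDomain (E := EuclideanSpace ℝ (Fin d)) (piMeasure f α p) =
        {M | MemMAlpha (α - q) M}) ∧
    (2 ≤ α - q →
      UpsilonDomain (E := EuclideanSpace ℝ (Fin d)) (piMeasure f α p) = {0}) := by
  have h := hf.hasPowerTail hq hqp
  have hdom (M : Measure (EuclideanSpace ℝ (Fin d))) :
      M ∈ UpsilonDomain (piMeasure f α p) ↔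
        IsLevyMeasure M ∧ ∫⁻ x, radialMass (piMeasure f 0 p) α ‖x‖ ∂M < ∞ :=
    and_congr_right fun hM => isLevyMeasure_Upsilon_iff hM hf.1 α p
  refine ⟨fun hα => ?_, fun hα => ?_, fun hα hα' => ?_, fun hα => ?_⟩ <;> ext M <;> rw [hdom]
  · exact and_iff_left_of_imp (h.lintegral_radialMass_lt_top_of_lt (by linarith))
  · obtain rfl : α = q := by linarith
    exact and_congr_right h.lintegral_radialMass_lt_top_iff_log
  · exact ⟨fun hM => h.memMAlpha_of_lintegral_radialMass_lt_top hM.1 hM.2, fun hM =>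
      ⟨hM.isLevyMeasure hα hα', h.lintegral_radialMass_lt_top_of_memMAlpha (by linarith) hα' hM⟩⟩
  · constructor
    · exact fun hM => h.eq_zero_of_lintegral_radialMass_lt_top (by linarith) hM.1 hM.2
    · rintro rfl
      exact ⟨isLevyMeasure_zero, by simp⟩
end
end
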